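/- arXiv:1304.3530 — 6 statements merged into one kernel-verified Lean document; each statement's English description precedes it below -/
import Mathlib

section
/- Let D₁ and D₂ be coprime odd positive integers with min(D₁,D₂) > 1 such that D₁·X₁² = 2^(Z₁) − λ and D₂ = 3·2^(Z₁) + λ for some positive integers X₁, Z₁ and some λ ∈ {1,−1}, and suppose (D₁,D₂) ≠ (31,97). Then the equation D₁·x² + D₂^m = 2^(n+2) has no solution in positive integers (x,m,n) with m even. -/
/-- The Lucas sequence of the first kind with parameters `P`, `Q`. -/
def lucasU (P Q : ℤ) : ℕ → ℤ
  | 0 => 0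
  | 1 => 1
  | n + 2 => P * lucasU P Q (n + 1) - Q * lucasU P Q n

/-- The Lucas sequence of the second kind with parameters `P`, `Q`. -/
def lucasV (P Q : ℤ) : ℕ → ℤ
  | 0 => 2
  | 1 => P
  | n + 2 => P * lucasV P Q (n + 1) - Q * lucasV P Q n

lemma two_mul_lucas_succ (P Q : ℤ) (n : ℕ) :
    2 * lucasV P Q (n + 1) = P * lucasV P Q n + (P ^ 2 - 4 * Q) * lucasU P Q n ∧
    2 * lucasU P Q (n + 1) = lucasV P Q n + P * lucasU P Q n := by
  induction n with
  | zero => simp [lucasU, lucasV]; ring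
  | succ n ih =>
    obtain ⟨h1, h2⟩ := ih
    simp only [lucasU, lucasV]
    constructor
    · have : 2 * (P * lucasV P Q (n + 1) - 2 * Q * lucasV P Q n) =
          2 * ((P ^ 2 - 4 * Q) * lucasU P Q (n + 1)) := by
        linear_combination P * h1 - (P ^ 2 - 4 * Q) * h2
      linarith
    · have : 2 * (P * lucasU P Q (n + 1) - 2 * Q * lucasU P Q n) =
          2 * lucasV P Q (n + 1) := by
        linear_combination P * h2 - h1
      linarith

lemma two_mul_lucas_add (P Q : ℤ) (m n : ℕ) :
    2 * lucasV P Q (m + n) =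
      lucasV P Q m * lucasV P Q n + (P ^ 2 - 4 * Q) * lucasU P Q m * lucasU P Q n ∧
    2 * lucasU P Q (m + n) =
      lucasU P Q m * lucasV P Q n + lucasV P Q m * lucasU P Q n := by
  induction n with
  | zero => simp [lucasU, lucasV]; constructor <;> ring
  | succ n ih =>
    obtain ⟨h1, h2⟩ := ih
    obtain ⟨h3, h4⟩ := two_mul_lucas_succ P Q n
    obtain ⟨h5, h6⟩ := two_mul_lucas_succ P Q (m + n)
    rw [← add_assoc]
    constructor
    · have : 2 * (2 * lucasV P Q (m + n + 1)) = 2 * (lucasV P Q m * lucasV P Q (n + 1) +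
          (P ^ 2 - 4 * Q) * lucasU P Q m * lucasU P Q (n + 1)) := by
        linear_combination 2 * h5 + P * h1 + (P ^ 2 - 4 * Q) * h2 - lucasV P Q m * h3 -
          (P ^ 2 - 4 * Q) * lucasU P Q m * h4
      linarith
    · have : 2 * (2 * lucasU P Q (m + n + 1)) = 2 * (lucasU P Q m * lucasV P Q (n + 1) +
          lucasV P Q m * lucasU P Q (n + 1)) := by
        linear_combination 2 * h6 + h1 + P * h2 - lucasU P Q m * h3 - lucasV P Q m * h4
      linarith

lemma lucasV_sq_sub (P Q : ℤ) (n : ℕ) :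
    lucasV P Q n ^ 2 - (P ^ 2 - 4 * Q) * lucasU P Q n ^ 2 = 4 * Q ^ n := by
  induction n with
  | zero => simp [lucasU, lucasV]
  | succ n ih =>
    obtain ⟨h1, h2⟩ := two_mul_lucas_succ P Q n
    have : 4 * (lucasV P Q (n + 1) ^ 2 - (P ^ 2 - 4 * Q) * lucasU P Q (n + 1) ^ 2) =
        4 * (4 * Q ^ (n + 1)) := by
      linear_combination (2 * lucasV P Q (n + 1) + (P * lucasV P Q n +
        (P ^ 2 - 4 * Q) * lucasU P Q n)) * h1 - (P ^ 2 - 4 * Q) * (2 * lucasU P Q (n + 1) +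
        (lucasV P Q n + P * lucasU P Q n)) * h2 + 4 * Q * ih
    linarith

lemma lucasV_add_add (P Q : ℤ) (m n : ℕ) :
    lucasV P Q (m + (m + n)) = lucasV P Q m * lucasV P Q (m + n) - Q ^ m * lucasV P Q n := by
  obtain ⟨h1, h2⟩ := two_mul_lucas_add P Q m n
  obtain ⟨h3, -⟩ := two_mul_lucas_add P Q m (m + n)
  have h4 := lucasV_sq_sub P Q m
  have : 4 * lucasV P Q (m + (m + n)) =
      4 * (lucasV P Q m * lucasV P Q (m + n) - Q ^ m * lucasV P Q n) := by
    linear_combination 2 * h3 - lucasV P Q m * h1 + (P ^ 2 - 4 * Q) * lucasU P Q m * h2 -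
      lucasV P Q n * h4
  linarith

lemma lucasV_mul (P Q : ℤ) (m n : ℕ) :
    lucasV P Q (m * n) = lucasV (lucasV P Q m) (Q ^ m) n := by
  induction n using Nat.twoStepInduction with
  | zero => simp [lucasV]
  | one => simp [lucasV]
  | more n ih1 ih2 =>
    have := lucasV_add_add P Q m (m * n)
    rw [show m * (n + 2) = m + (m + m * n) by ring, this, show m + m * n = m * (n + 1) by ring,
      ih1, ih2, lucasV]

lemma lucasV_two_mul (P Q : ℤ) (n : ℕ) :
    lucasV P Q (2 * n) = lucasV P Q n ^ 2 - 2 * Q ^ n := by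
  rw [mul_comm, lucasV_mul]
  simp [lucasV]
  ring

lemma dvd_lucasV_of_odd (P Q : ℤ) {n : ℕ} (hn : Odd n) : P ∣ lucasV P Q n := by
  obtain ⟨k, rfl⟩ := hn
  induction k with
  | zero => simp [lucasV]
  | succ k ih =>
    rw [show 2 * (k + 1) + 1 = 2 * k + 1 + 2 by ring, lucasV]
    exact dvd_sub (dvd_mul_right _ _) (ih.mul_left _)

lemma sq_dvd_lucasV_one_sub (Q : ℤ) (n : ℕ) :
    Q ^ 2 ∣ lucasV 1 Q (n + 2) - (1 - (n + 2) * Q) := by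
  induction n using Nat.twoStepInduction with
  | zero => simp [lucasV]; ring_nf; simp
  | one => exact ⟨0, by simp [lucasV]; ring⟩
  | more n ih1 ih2 =>
    obtain ⟨c, hc⟩ := ih1
    obtain ⟨d, hd⟩ := ih2
    refine ⟨d - Q * c + (n + 2), ?_⟩
    rw [lucasV]
    push_cast at *
    linear_combination hd - Q * hc

/-- In an imaginary quadratic order where `2` splits, the primitive elements whose norm is a power
of `2` are, up to sign and conjugation, the powers of the one of least norm. -/
lemma exists_eq_lucas_of_minimal {D a₀ b₀ : ℤ} {s : ℕ} (hs : 1 ≤ s) (hD : 4 < D) (hDodd : Odd D)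
    (ha₀ : Odd a₀) (hb₀ : Odd b₀) (h₀ : a₀ ^ 2 + D * b₀ ^ 2 = 2 ^ (s + 2))
    (hmin : ∀ (n : ℕ) (a b : ℤ), 1 ≤ n → Odd a → Odd b → a ^ 2 + D * b ^ 2 = 2 ^ (n + 2) → s ≤ n)
    (n : ℕ) : ∀ a b : ℤ, 1 ≤ n → Odd a → Odd b → a ^ 2 + D * b ^ 2 = 2 ^ (n + 2) →
      ∃ (r : ℕ) (σ τ : ℤ), 1 ≤ r ∧ n = s * r ∧ (σ = 1 ∨ σ = -1) ∧ (τ = 1 ∨ τ = -1) ∧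
        a = σ * lucasV a₀ (2 ^ s) r ∧ b = τ * (b₀ * lucasU a₀ (2 ^ s) r) := by
  induction n using Nat.strong_induction_on with
  | _ n ih =>
  have key : ∀ a b : ℤ, 1 ≤ n → Odd a → Odd b → a ^ 2 + D * b ^ 2 = 2 ^ (n + 2) →
      (2 : ℤ) ^ (s + 1) ∣ a₀ * b - a * b₀ →
      ∃ (r : ℕ) (σ τ : ℤ), 1 ≤ r ∧ n = s * r ∧ (σ = 1 ∨ σ = -1) ∧ (τ = 1 ∨ τ = -1) ∧
        a = σ * lucasV a₀ (2 ^ s) r ∧ b = τ * (b₀ * lucasU a₀ (2 ^ s) r) := by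
    rintro a b hn ha hb h ⟨b', hb'⟩
    obtain ⟨d, rfl⟩ := Nat.exists_eq_add_of_le (hmin n a b hn ha hb h)
    have h2 : ((2 : ℤ) ^ (s + 1)) ≠ 0 := by positivity
    have hpow : ((2 : ℤ) ^ (s + 2)) = 2 * 2 ^ (s + 1) := by ring
    have hnorm : (a * a₀ + D * b * b₀) ^ 2 + D * (2 ^ (s + 1) * b') ^ 2 =
        (2 ^ (s + 1)) ^ 2 * 2 ^ (d + 2) := by
      rw [← hb']
      linear_combination (a₀ ^ 2 + D * b₀ ^ 2) * h + 2 ^ (s + d + 2) * h₀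
    obtain ⟨a', ha'⟩ : (2 : ℤ) ^ (s + 1) ∣ a * a₀ + D * b * b₀ := by
      rw [← Int.pow_dvd_pow_iff (n := 2) (by norm_num)]
      exact ⟨2 ^ (d + 2) - D * b' ^ 2, by linear_combination hnorm⟩
    have hn' : a' ^ 2 + D * b' ^ 2 = 2 ^ (d + 2) := by
      rw [ha'] at hnorm
      apply mul_left_cancel₀ (pow_ne_zero 2 h2)
      linear_combination hnorm
    have h2a : 2 * a = a₀ * a' - D * b₀ * b' := by
      apply mul_left_cancel₀ h2
      linear_combination a₀ * ha' - D * b₀ * hb' - a * h₀ + a * hpow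
    have h2b : 2 * b = a₀ * b' + b₀ * a' := by
      apply mul_left_cancel₀ h2
      linear_combination a₀ * hb' + b₀ * ha' - b * h₀ + b * hpow
    rcases Nat.eq_zero_or_pos d with rfl | hd
    · have hb0 : b' = 0 := by
        by_contra hne
        have : 0 < b' ^ 2 := by positivity
        norm_num at hn'
        nlinarith [sq_nonneg a']
      subst hb0
      have : (a' - 2) * (a' + 2) = 0 := by linear_combination hn'
      rcases mul_eq_zero.mp this with h' | h'
      · exact ⟨1, 1, 1, le_rfl, by simp, .inl rfl, .inl rfl, by
          simp only [lucasV]; nlinarith, by simp only [lucasU]; nlinarith⟩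
      · obtain rfl : a' = -2 := by linarith
        exact ⟨1, -1, -1, le_rfl, by simp, .inr rfl, .inr rfl, by
          simp only [lucasV]; linarith, by simp only [lucasU]; linarith⟩
    · have hbodd : Odd b' := by
        obtain ⟨c, hc⟩ : (2 : ℤ) ∣ a₀ * b + a * b₀ :=
          even_iff_two_dvd.mp ((ha₀.mul hb).add_odd (ha.mul hb₀))
        have h3 : b' * c = b ^ 2 - 2 ^ d * b₀ ^ 2 := by
          apply mul_left_cancel₀ (show ((2 : ℤ) ^ (s + 2)) ≠ 0 by positivity)
          have e : (2 : ℤ) ^ (s + d + 2) = 2 ^ (s + 2) * 2 ^ d := by ring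
          linear_combination (-2 * c) * hb' - (a₀ * b - a * b₀) * hc + b ^ 2 * h₀ - b₀ ^ 2 * h
            - b₀ ^ 2 * e + b' * c * hpow
        have : Odd (b ^ 2 - 2 ^ d * b₀ ^ 2) := by
          refine hb.pow.sub_even (Even.mul_right ?_ _)
          exact (even_two).pow_of_ne_zero (by omega)
        rw [← h3] at this
        exact (Int.odd_mul.mp this).1
      have haodd : Odd a' := by
        have : Odd (a' ^ 2) := by
          rw [show a' ^ 2 = 2 ^ (d + 2) - D * b' ^ 2 by linarith]
          exact ((even_two).pow_of_ne_zero (by omega)).sub_odd (hDodd.mul hbodd.pow)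
        exact (Int.odd_pow' (by norm_num)).mp this
      obtain ⟨r, σ, τ, hr, hdr, hσ, hτ, hV, hU⟩ := ih d (by omega) a' b' hd haodd hbodd hn'
      obtain ⟨l1, l2⟩ := two_mul_lucas_succ a₀ (2 ^ s) r
      have hΔ : a₀ ^ 2 - 4 * 2 ^ s = - (D * b₀ ^ 2) := by linear_combination h₀
      rw [hΔ] at l1
      by_cases hστ : σ = τ
      · subst hστ
        refine ⟨r + 1, σ, σ, by omega, by rw [hdr]; ring, hσ, hσ, ?_, ?_⟩
        · have : 2 * a = 2 * (σ * lucasV a₀ (2 ^ s) (r + 1)) := by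
            rw [h2a, hV, hU]; linear_combination -σ * l1
          linarith
        · have : 2 * b = 2 * (σ * (b₀ * lucasU a₀ (2 ^ s) (r + 1))) := by
            rw [h2b, hV, hU]; linear_combination -σ * b₀ * l2
          linarith
      · exfalso
        have hτσ : τ = -σ := by
          rcases hσ with rfl | rfl <;> rcases hτ with rfl | rfl <;> simp_all
        obtain ⟨q, rfl⟩ : ∃ q, r = q + 1 := ⟨r - 1, by omega⟩
        obtain ⟨l3, l4⟩ := two_mul_lucas_succ a₀ (2 ^ s) q
        have : a = σ * 2 ^ s * lucasV a₀ (2 ^ s) q := by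
          have : 4 * a = 4 * (σ * 2 ^ s * lucasV a₀ (2 ^ s) q) := by
            rw [hV, hU, hτσ] at h2a
            linear_combination 2 * h2a + σ * a₀ * l3 + D * b₀ ^ 2 * σ * l4 +
              σ * (lucasV a₀ (2 ^ s) q + a₀ * lucasU a₀ (2 ^ s) q) * hΔ
          linarith
        rw [← Int.not_even_iff_odd] at ha
        apply ha
        rw [this]
        exact Even.mul_right (Even.mul_left ((even_two).pow_of_ne_zero (by omega)) _) _
  intro a b hn ha hb h
  have hsn := hmin n a b hn ha hb h
  obtain ⟨y, hy⟩ : (2 : ℤ) ∣ a₀ * b - a * b₀ :=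
    even_iff_two_dvd.mp ((ha₀.mul hb).sub_odd (ha.mul hb₀))
  have hz : a₀ * b + a * b₀ = 2 * (y + a * b₀) := by linarith
  have hyz : (2 : ℤ) ^ s ∣ y * (y + a * b₀) := by
    obtain ⟨d, rfl⟩ := Nat.exists_eq_add_of_le hsn
    refine ⟨b ^ 2 - 2 ^ d * b₀ ^ 2, ?_⟩
    have e : (2 : ℤ) ^ (s + d + 2) = 4 * (2 ^ s * 2 ^ d) := by ring
    have : 4 * (y * (y + a * b₀)) = 4 * (2 ^ s * (b ^ 2 - 2 ^ d * b₀ ^ 2)) := by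
      linear_combination (-2 * (y + a * b₀)) * hy - (a₀ * b - a * b₀) * hz + b ^ 2 * h₀
        - b₀ ^ 2 * h - b₀ ^ 2 * e
    linarith
  have hcop : ∀ z : ℤ, Odd z → IsCoprime ((2 : ℤ) ^ s) z := fun z hz => by
    obtain ⟨k, rfl⟩ := hz
    exact IsCoprime.pow_left ⟨-k, 1, by ring⟩
  rcases Int.even_or_odd y with hye | hyo
  · have : (2 : ℤ) ^ s ∣ y := (hcop _ (hye.add_odd (ha.mul hb₀))).dvd_of_dvd_mul_right hyz
    apply key a b hn ha hb h
    rw [hy, pow_succ']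
    exact mul_dvd_mul_left 2 this
  · have : (2 : ℤ) ^ s ∣ y + a * b₀ := (hcop _ hyo).dvd_of_dvd_mul_left hyz
    obtain ⟨r, σ, τ, hr, hnr, hσ, hτ, hV, hU⟩ := key a (-b) hn ha hb.neg (by simpa using h) (by
      rw [show a₀ * -b - a * b₀ = -((y + a * b₀) * 2) by linarith, dvd_neg, pow_succ]
      exact mul_dvd_mul this dvd_rfl)
    exact ⟨r, σ, -τ, hr, hnr, hσ, by omega, hV, by linarith⟩

lemma eq_add_two_of_sq_eq {A B m : ℕ} (hB : Odd B) (h : A ^ 2 = B ^ 2 + 2 ^ m) :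
    A = B + 2 ∧ 2 ^ m = 4 * (B + 1) := by
  have hlt : B < A := by
    have : 0 < 2 ^ m := by positivity
    exact lt_of_pow_lt_pow_left₀ 2 (by omega) (by omega)
  obtain ⟨d, rfl⟩ := Nat.exists_eq_add_of_lt hlt
  have hd : (d + 1) * (d + 1 + 2 * B) = 2 ^ m := by linarith
  obtain ⟨i, -, hi⟩ := (Nat.dvd_prime_pow Nat.prime_two).mp (Dvd.intro _ hd)
  obtain ⟨j, -, hj⟩ := (Nat.dvd_prime_pow Nat.prime_two).mp (Dvd.intro_left _ hd)
  obtain ⟨c, rfl⟩ := hB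
  suffices d + 1 = 2 by
    obtain rfl : d = 1 := by omega
    exact ⟨by omega, by rw [← hd]; ring⟩
  match i, j with
  | 0, 0 => omega
  | 0, j + 1 => rw [pow_succ] at hj; omega
  | 1, _ => simpa using hi
  | i + 2, 0 => omega
  | i + 2, 1 => rw [pow_add] at hi; have := Nat.one_le_two_pow (n := i); omega
  | i + 2, j + 2 => rw [pow_add] at hi hj; omega

lemma two_pow_dvd_of_dvd_ninetySeven_pow_sub_one (c : ℕ) :
    ∀ i : ℕ, (2 : ℤ) ^ (c + 5) ∣ 97 ^ i - 1 → 2 ^ c ∣ i := by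
  induction c with
  | zero => simp
  | succ c ih =>
    intro i h
    have h64 : (64 : ℤ) ∣ 97 ^ i - 1 := dvd_trans ⟨2 ^ c, by ring⟩ h
    have hmod : ∀ j : ℕ, (97 : ℤ) ^ (2 * j) % 64 = 1 := fun j => by
      rw [pow_mul]
      have : (97 ^ 2 : ℤ) ^ j ≡ 1 ^ j [ZMOD 64] := Int.ModEq.pow j (by decide)
      simpa [Int.ModEq] using this
    rcases Nat.even_or_odd' i with ⟨j, rfl | rfl⟩
    · obtain ⟨u, hu⟩ : ∃ u : ℤ, (97 : ℤ) ^ j + 1 = 2 * (2 * u + 1) := by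
        have : (97 : ℤ) ^ j ≡ 1 ^ j [ZMOD 4] := Int.ModEq.pow j (by decide)
        rw [one_pow] at this
        obtain ⟨u, hu⟩ := this.symm.dvd
        exact ⟨u, by linarith⟩
      have hcop : IsCoprime ((2 : ℤ) ^ (c + 5)) (2 * u + 1) :=
        IsCoprime.pow_left ⟨-u, 1, by ring⟩
      have h' : (2 : ℤ) ^ (c + 5) ∣ (97 ^ j - 1) * (2 * u + 1) := by
        obtain ⟨v, hv⟩ := h
        refine ⟨v, ?_⟩
        have e : (97 : ℤ) ^ (2 * j) = (97 ^ j) ^ 2 := by rw [← pow_mul, mul_comm]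
        have : 2 * ((97 ^ j - 1) * (2 * u + 1)) = 2 * ((2 : ℤ) ^ (c + 5) * v) := by
          linear_combination hv - e - (97 ^ j - 1) * hu
        linarith
      rw [pow_succ']
      exact mul_dvd_mul_left 2 (ih j (hcop.dvd_of_dvd_mul_right h'))
    · have := hmod j
      rw [pow_succ] at h64
      omega

lemma ninetySeven_pow_ne {e : ℕ} (he : 4 ≤ e) (i : ℕ) :
    2 * ((2 : ℤ) ^ e) ^ 2 - 4 * 2 ^ e + 1 ≠ 97 ^ i := by
  obtain ⟨f, rfl⟩ := Nat.exists_eq_add_of_le' he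
  intro h
  have hdvd : 2 ^ (f + 1) ∣ i := by
    apply two_pow_dvd_of_dvd_ninetySeven_pow_sub_one
    exact ⟨2 ^ (f + 3) - 1, by rw [← h]; ring⟩
  have hi0 : i ≠ 0 := by
    rintro rfl
    have : (1 : ℤ) ≤ 2 ^ f := one_le_pow₀ (by norm_num)
    rw [pow_add] at h
    nlinarith
  have hi : f + 2 ≤ i := (Nat.lt_two_pow_self (n := f + 1)).trans_le
    (Nat.le_of_dvd (Nat.pos_of_ne_zero hi0) hdvd)
  have h1 : (97 : ℤ) ^ (f + 2) ≤ 97 ^ i := pow_le_pow_right₀ (by norm_num) hi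
  have h2 : (4 : ℤ) ^ f ≤ 97 ^ f := pow_le_pow_left₀ (by norm_num) (by norm_num) f
  have h3 : ((2 : ℤ) ^ (f + 4)) ^ 2 = 256 * 4 ^ f := by
    rw [← pow_mul, show (f + 4) * 2 = 2 * f + 8 by ring, pow_add, pow_mul]
    norm_num
    ring
  have h4 : (1 : ℤ) ≤ 2 ^ (f + 4) := one_le_pow₀ (by norm_num)
  have h5 : (0 : ℤ) < 4 ^ f := by positivity
  rw [pow_add] at h1
  linarith

lemma lucasV_one_sq_le {Q : ℤ} (hQ : 1 ≤ Q) (n : ℕ) : lucasV 1 Q n ^ 2 ≤ 4 * Q ^ n := by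
  have := lucasV_sq_sub 1 Q n
  nlinarith [sq_nonneg (lucasV 1 Q n), mul_nonneg (show 0 ≤ 4 * Q - 1 by linarith)
    (sq_nonneg (lucasU 1 Q n))]

lemma sq_dvd_one_add_pow_sub (x : ℤ) (k : ℕ) : x ^ 2 ∣ (x + 1) ^ k - (1 + k * x) := by
  induction k with
  | zero => simp
  | succ k ih =>
    obtain ⟨c, hc⟩ := ih
    refine ⟨c * (x + 1) + k, ?_⟩
    push_cast
    linear_combination (x + 1) * hc

/-- For `N = 2 ^ e ≥ 8`, the Lucas sequence `V(1, N)` contains a power of `12 N + 1` only if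
`N = 8`. -/
lemma eq_three_of_lucasV_eq_pow {e r k : ℕ} (he : 3 ≤ e) (hr : 1 ≤ r) (hk : 1 ≤ k)
    (h : lucasV 1 (2 ^ e) r = (12 * 2 ^ e + 1) ^ k ∨
      lucasV 1 (2 ^ e) r = -(12 * 2 ^ e + 1) ^ k) : e = 3 := by
  have hN : (8 : ℤ) ∣ 2 ^ e := pow_dvd_pow 2 he
  set N : ℤ := 2 ^ e with hNdef
  have hN0 : 0 < N := by positivity
  have hN8 : 8 ≤ N := Int.le_of_dvd hN0 hN
  obtain ⟨c, hc⟩ : N ^ 2 ∣ (12 * N + 1) ^ k - (1 + k * (12 * N)) :=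
    (pow_dvd_pow_of_dvd (dvd_mul_left N 12) 2).trans (sq_dvd_one_add_pow_sub (12 * N) k)
  have hone : 1 < (12 * N + 1) ^ k := one_lt_pow₀ (by linarith) (by omega)
  obtain ⟨q, rfl⟩ : ∃ q, r = q + 2 := by
    refine ⟨r - 2, ?_⟩
    have : r ≠ 1 := by
      rintro rfl
      simp only [lucasV] at h
      omega
    omega
  obtain ⟨d, hd⟩ := sq_dvd_lucasV_one_sub N q
  have hV : lucasV 1 N (q + 2) = (12 * N + 1) ^ k := by
    refine h.resolve_right fun h => ?_
    have : N ∣ 2 := ⟨(q + 2) - 12 * k - N * c - N * d, by rw [h] at hd; linear_combination -hd - hc⟩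
    have := Int.le_of_dvd (by norm_num) this
    linarith
  have h8 : (8 : ℤ) ∣ (q + 2) + 12 * k := by
    refine hN.trans ⟨d - c, ?_⟩
    apply mul_left_cancel₀ hN0.ne'
    rw [hV] at hd
    linear_combination hd - hc
  obtain ⟨w, hw⟩ : 4 ∣ q + 2 := by omega
  have hNe : ∀ n, N ^ n = 2 ^ (e * n) := fun n => by rw [hNdef, pow_mul]
  have hkodd : Odd k := by
    rw [← Nat.not_even_iff_odd]
    rintro ⟨l, rfl⟩
    rw [hw, show 4 * w = 2 * (2 * w) by ring, lucasV_two_mul] at hV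
    have hA : (lucasV 1 N (2 * w)).natAbs ^ 2 =
        ((12 * 2 ^ e + 1) ^ l) ^ 2 + 2 ^ (e * (2 * w) + 1) := by
      zify
      rw [sq_abs, ← hNdef, pow_succ (2 : ℤ), ← hNe]
      linear_combination hV
    obtain ⟨h1, h2⟩ := eq_add_two_of_sq_eq
      (Odd.pow ((Nat.even_mul.mpr (.inl (by decide))).add_one)) hA
    have h3 := lucasV_one_sq_le (by linarith : 1 ≤ N) (2 * w)
    have h4 : (lucasV 1 N (2 * w)).natAbs ^ 2 ≤ 4 * 2 ^ (e * (2 * w)) := by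
      zify
      rw [sq_abs, ← hNe]
      exact h3
    have h5 : 2 ^ 6 ≤ 2 ^ (e * (2 * w)) := Nat.pow_le_pow_right (by norm_num)
      (Nat.mul_le_mul he (show 2 ≤ 2 * w by omega))
    rw [pow_succ] at h2
    rw [h1] at h4
    nlinarith
  have hwodd : Odd w := by
    obtain ⟨l, rfl⟩ := hkodd
    rw [Nat.odd_iff]
    omega
  have hV4 : lucasV 1 N 4 = 2 * N ^ 2 - 4 * N + 1 := by simp [lucasV]; ring
  have hV4dvd : 2 * N ^ 2 - 4 * N + 1 ∣ (12 * N + 1) ^ k := by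
    rw [← hV, hw, lucasV_mul, ← hV4]
    exact dvd_lucasV_of_odd _ _ hwodd
  have hpos : 0 < 2 * N ^ 2 - 4 * N + 1 := by nlinarith
  have hpow := Nat.eq_prime_pow_of_unique_prime_dvd (n := (2 * N ^ 2 - 4 * N + 1).natAbs)
    (p := 97) (by omega) (fun {p} hp hpd => by
      have h1 : (p : ℤ) ∣ 2 * N ^ 2 - 4 * N + 1 := Int.natCast_dvd.mpr hpd
      have h2 : (p : ℤ) ∣ 12 * N + 1 :=
        (Nat.prime_iff_prime_int.mp hp).dvd_of_dvd_pow (h1.trans hV4dvd)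
      have h3 : (p : ℤ) ∣ 194 := by
        have := dvd_sub (h1.mul_left 144) (h2.mul_left (24 * N - 50))
        ring_nf at this
        exact this
      have h4 : p ∣ 2 * 97 := by exact_mod_cast h3
      rcases (Nat.Prime.dvd_mul hp).mp h4 with h5 | h5
      · obtain rfl := (Nat.prime_dvd_prime_iff_eq hp Nat.prime_two).mp h5
        push_cast at h2
        omega
      · exact (Nat.prime_dvd_prime_iff_eq hp (by norm_num)).mp h5)
  by_contra hne
  apply ninetySeven_pow_ne (show 4 ≤ e by omega)
    ((2 * N ^ 2 - 4 * N + 1).natAbs.primeFactorsList.length)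
  rw [← hNdef]
  zify at hpow
  rw [← hpow, abs_of_pos hpos]

lemma lucasV_one_two_emod_eight (q : ℕ) :
    lucasV 1 2 (2 * q + 3) % 8 = 3 ∧ lucasV 1 2 (2 * q + 4) % 8 = 1 := by
  induction q with
  | zero => simp [lucasV]
  | succ q ih =>
    rw [show 2 * (q + 1) + 3 = 2 * q + 5 by ring, show 2 * (q + 1) + 4 = 2 * q + 6 by ring]
    simp only [lucasV] at *
    omega

lemma lucasV_one_two_emod_five (q : ℕ) :
    lucasV 1 2 (6 * q + 3) % 5 = 0 ∧ lucasV 1 2 (6 * q + 4) % 5 ≠ 0 := by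
  induction q with
  | zero => simp [lucasV]
  | succ q ih =>
    rw [show 6 * (q + 1) + 3 = 6 * q + 9 by ring, show 6 * (q + 1) + 4 = 6 * q + 10 by ring]
    simp only [lucasV] at *
    omega

lemma lucasV_one_two_emod_sixteen (q : ℕ) :
    lucasV 1 2 (4 * q + 4) % 16 = 1 ∧ lucasV 1 2 (4 * q + 5) % 16 = 11 := by
  induction q with
  | zero => simp [lucasV]
  | succ q ih =>
    rw [show 4 * (q + 1) + 4 = 4 * q + 8 by ring, show 4 * (q + 1) + 5 = 4 * q + 9 by ring]
    simp only [lucasV] at *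
    omega

lemma lucasV_one_four_emod (q : ℕ) :
    (lucasV 1 4 (4 * q + 2) % 16 = 9 ∧ lucasV 1 4 (4 * q + 3) % 16 = 5) ∧
    (lucasV 1 4 (4 * q + 2) % 7 = 0 ∧ lucasV 1 4 (4 * q + 3) % 7 ≠ 0) := by
  induction q with
  | zero => simp [lucasV]
  | succ q ih =>
    rw [show 4 * (q + 1) + 2 = 4 * q + 6 by ring, show 4 * (q + 1) + 3 = 4 * q + 7 by ring]
    simp only [lucasV] at *
    omega

/-- Away from small indices, `V(1, 2)` takes values `≡ ±1 (mod 16)` only at multiples of `4`. -/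
lemma four_dvd_of_lucasV_one_two {r : ℕ} (hr : 2 ≤ r)
    (h : lucasV 1 2 r % 16 = 1 ∨ lucasV 1 2 r % 16 = 15) : 4 ∣ r := by
  by_cases hr4 : r < 4
  · interval_cases r <;> simp [lucasV] at h
  · obtain ⟨h1, h2⟩ := lucasV_one_two_emod_sixteen (r / 4 - 1)
    have : r % 4 < 4 := Nat.mod_lt _ (by norm_num)
    obtain ⟨j, hj, hrj⟩ : ∃ j < 4, r = 4 * (r / 4 - 1) + 4 + j := ⟨r % 4, this, by omega⟩
    generalize r / 4 - 1 = q at *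
    subst hrj
    interval_cases j <;> simp only [lucasV, add_zero] at * <;> omega

lemma lucasV_one_two_ne_pow {r k : ℕ} (hr : 1 ≤ r) (hk : 1 ≤ k) :
    ¬ (lucasV 1 2 r = 25 ^ k ∨ lucasV 1 2 r = -25 ^ k) := by
  have h25 : (25 : ℤ) ^ k % 40 = 25 := by
    induction k, hk using Nat.le_induction with
    | base => rfl
    | succ k _ ih => rw [pow_succ]; omega
  intro h
  have h' : lucasV 1 2 r % 40 = 25 ∨ lucasV 1 2 r % 40 = 15 := by omega
  by_cases hr3 : r < 3
  · interval_cases r <;> simp [lucasV] at h'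
  · have hodd : ¬ Odd r := fun ⟨l, hl⟩ => by
      have := (lucasV_one_two_emod_eight (l - 1)).1
      rw [show 2 * (l - 1) + 3 = r by omega] at this
      omega
    obtain ⟨h1, h2⟩ := lucasV_one_two_emod_five ((r - 3) / 6)
    obtain ⟨j, hj, hrj⟩ : ∃ j < 6, r = 6 * ((r - 3) / 6) + 3 + j :=
      ⟨(r - 3) % 6, Nat.mod_lt _ (by norm_num), by omega⟩
    have hj2 : j % 2 = 1 := by rw [Nat.odd_iff] at hodd; omega
    have h5 : lucasV 1 2 r % 5 = 0 := by omega
    generalize (r - 3) / 6 = q at *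
    clear h h'
    subst hrj
    interval_cases j <;> simp only [lucasV, add_zero] at * <;> omega

lemma lucasV_one_four_ne_pow {r k : ℕ} (hr : 1 ≤ r) (hk : 1 ≤ k) :
    ¬ (lucasV 1 4 r = 49 ^ k ∨ lucasV 1 4 r = -49 ^ k) := by
  have h49 : (49 : ℤ) ^ k % 112 = 49 := by
    induction k, hk using Nat.le_induction with
    | base => rfl
    | succ k _ ih => rw [pow_succ]; omega
  intro h
  have h' : lucasV 1 4 r % 112 = 49 ∨ lucasV 1 4 r % 112 = 63 := by omega
  by_cases hr2 : r < 2
  · interval_cases r; simp [lucasV] at h'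
  · obtain ⟨⟨h1, h2⟩, h3, h4⟩ := lucasV_one_four_emod ((r - 2) / 4)
    obtain ⟨j, hj, hrj⟩ : ∃ j < 4, r = 4 * ((r - 2) / 4) + 2 + j :=
      ⟨(r - 2) % 4, Nat.mod_lt _ (by norm_num), by omega⟩
    generalize (r - 2) / 4 = q at *
    clear h
    subst hrj
    interval_cases j <;> simp only [lucasV, add_zero] at * <;> omega

/-- If `D X² + 1` is a power of `2`, then the least primitive element of `2`-power norm in the
quadratic order of discriminant `-D` is `(1 + X √-D) / 2`, apart from one case with `D = 7`. -/
lemma minimal_of_lucasV_eq {D a₀ b₀ X : ℤ} {s t : ℕ} (hs : 1 ≤ s) (ht : 1 ≤ t) (hD : D % 8 = 7)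
    (hDpos : 0 < D) (ha₀pos : 0 < a₀) (ha₀ : Odd a₀) (hb₀ : Odd b₀)
    (h₀ : a₀ ^ 2 + D * b₀ ^ 2 = 2 ^ (s + 2))
    (hmin : ∀ (n : ℕ) (a b : ℤ), 1 ≤ n → Odd a → Odd b → a ^ 2 + D * b ^ 2 = 2 ^ (n + 2) → s ≤ n)
    (hX : 1 + D * X ^ 2 = 2 ^ (s * t + 2))
    (hV : lucasV a₀ (2 ^ s) t = 1 ∨ lucasV a₀ (2 ^ s) t = -1) :
    a₀ = 1 ∧ (t = 1 ∨ s = 1 ∧ t = 4) := by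
  have hbpos : 1 ≤ b₀ ^ 2 := by
    have : b₀ ≠ 0 := by rintro rfl; simp at hb₀
    have : 0 < b₀ ^ 2 := by positivity
    omega
  rcases Nat.even_or_odd' t with ⟨w, rfl | rfl⟩
  · rw [lucasV_two_mul, ← pow_mul] at hV
    have hsw : 1 ≤ s * w := Nat.mul_pos hs (by omega)
    have hVodd : Odd (lucasV a₀ (2 ^ s) w) := by
      have : Odd (lucasV a₀ (2 ^ s) w ^ 2) := by
        rcases hV with h | h
        · exact ⟨2 ^ (s * w), by linarith⟩
        · exact ⟨2 ^ (s * w) - 1, by linarith⟩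
      exact (Int.odd_pow' (by norm_num)).mp this
    have h8 := Int.sq_mod_four_eq_one_of_odd hVodd
    have hsq : lucasV a₀ (2 ^ s) w ^ 2 = 1 + 2 ^ (s * w + 1) := by
      rcases hV with h | h
      · rw [pow_succ (2 : ℤ)]; linarith
      · exfalso
        obtain ⟨v, hv⟩ : ∃ v, s * w = v + 1 := ⟨s * w - 1, by omega⟩
        rw [hv, pow_succ (2 : ℤ)] at h
        omega
    obtain ⟨-, h3⟩ := eq_add_two_of_sq_eq (A := (lucasV a₀ (2 ^ s) w).natAbs) (B := 1)
      (m := s * w + 1) odd_one (by zify; rw [sq_abs]; linarith)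
    have hsw2 : s * w = 2 := by
      have : 2 ^ (s * w + 1) = 2 ^ 3 := by rw [h3]; norm_num
      have := Nat.pow_right_injective le_rfl this
      omega
    have hs2 : s ≤ 2 := Nat.le_of_dvd (by norm_num) (Dvd.intro _ hsw2)
    have h16 : (2 : ℤ) ^ (s + 2) ≤ 2 ^ 4 := pow_le_pow_right₀ (by norm_num) (by omega)
    have hDle : D ≤ 15 := by nlinarith
    rw [show s * (2 * w) + 2 = 6 by linarith] at hX
    have hD7 : D = 7 := by
      have : D = 7 ∨ D = 15 := by omega
      rcases this with h | h
      · exact h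
      · subst h; omega
    subst hD7
    have hs1 : s = 1 := by
      have := hmin 1 1 1 le_rfl odd_one odd_one (by norm_num)
      omega
    subst hs1
    norm_num at h₀
    exact ⟨by nlinarith, .inr ⟨rfl, by omega⟩⟩
  · have ha₀1 : a₀ = 1 := by
      have := dvd_lucasV_of_odd a₀ (2 ^ s) (odd_two_mul_add_one w)
      have h1 : a₀ ∣ 1 := by
        rcases hV with h | h <;> rw [h] at this
        · exact this
        · exact (dvd_neg.mp this)
      exact Int.eq_one_of_dvd_one ha₀pos.le h1
    subst ha₀1
    refine ⟨rfl, .inl ?_⟩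
    by_contra ht1
    obtain ⟨v, rfl⟩ : ∃ v, w = v + 1 := ⟨w - 1, by omega⟩
    rw [show 2 * (v + 1) + 1 = 2 * v + 1 + 2 by ring] at hV
    obtain ⟨c, hc⟩ := sq_dvd_lucasV_one_sub (2 ^ s) (2 * v + 1)
    have h2s : (2 : ℤ) ∣ 2 ^ s := dvd_pow_self 2 (by omega)
    have h2pos : (0 : ℤ) < 2 ^ s := by positivity
    rcases hV with h | h
    · rw [h] at hc
      push_cast at hc
      have : 2 * (v : ℤ) + 1 + 2 = 2 ^ s * c := by
        apply mul_left_cancel₀ h2pos.ne'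
        linear_combination hc
      have := h2s.trans (Dvd.intro _ this.symm)
      omega
    · have h2 : (2 : ℤ) ^ s ∣ 2 := by
        rw [h] at hc
        push_cast at hc
        exact ⟨2 * v + 3 - 2 ^ s * c, by linear_combination -hc⟩
      have : (2 : ℤ) ^ s = 2 := by
        have := Int.le_of_dvd (by norm_num) h2
        omega
      rw [this] at h
      have := four_dvd_of_lucasV_one_two (r := 2 * v + 1 + 2) (by omega) (by rw [h]; norm_num)
      omega


/-- If coprime odd `D₁, D₂` both `> 1` satisfy `D₁·X₁² = 2^Z₁ - λ` and
`D₂ = 3·2^Z₁ + λ` for some positive integers `X₁, Z₁` and `λ ∈ {1, -1}`,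
and `(D₁, D₂) ≠ (31, 97)`, then `D₁·x² + D₂^m = 2^(n+2)` has no positive
solution `(x, m, n)` with `m` even. -/
theorem stmt_14 (D₁ D₂ X₁ Z₁ : ℕ) (lam : ℤ) (hlam : lam = 1 ∨ lam = -1)
    (hD₁odd : Odd D₁) (hD₂odd : Odd D₂) (hcop : Nat.Coprime D₁ D₂)
    (hD₁ : 1 < D₁) (hD₂ : 1 < D₂) (hX₁ : 0 < X₁) (hZ₁ : 0 < Z₁)
    (h1 : (D₁ : ℤ) * (X₁ : ℤ) ^ 2 = 2 ^ Z₁ - lam)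
    (h2 : (D₂ : ℤ) = 3 * 2 ^ Z₁ + lam)
    (hne : (D₁, D₂) ≠ (31, 97)) :
    ¬ ∃ x m n : ℕ, 0 < x ∧ 0 < m ∧ 0 < n ∧ Even m ∧
      D₁ * x ^ 2 + D₂ ^ m = 2 ^ (n + 2) := by
  rintro ⟨x, m, n, hx, hm, hn, ⟨k, rfl⟩, h⟩
  have hk : 1 ≤ k := by omega
  have heq : ((D₂ : ℤ) ^ k) ^ 2 + D₁ * (x : ℤ) ^ 2 = 2 ^ (n + 2) := by
    have : (D₁ : ℤ) * x ^ 2 + D₂ ^ (k + k) = 2 ^ (n + 2) := by exact_mod_cast h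
    rw [← this]
    ring
  have hDodd : Odd (D₁ : ℤ) := by exact_mod_cast hD₁odd
  have hD₂k : Odd ((D₂ : ℤ) ^ k) := Odd.pow (by exact_mod_cast hD₂odd)
  have hxodd : Odd (x : ℤ) := by
    have : Odd ((D₁ : ℤ) * x ^ 2) := by
      rw [show (D₁ : ℤ) * x ^ 2 = 2 ^ (n + 2) - (D₂ ^ k) ^ 2 by linarith]
      exact (even_two.pow_of_ne_zero (by omega)).sub_odd hD₂k.pow
    exact (Int.odd_pow' (by norm_num)).mp (Int.odd_mul.mp this).2
  have hX₁odd : Odd (X₁ : ℤ) := by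
    have : Odd ((D₁ : ℤ) * X₁ ^ 2) := by
      rw [h1]
      exact (even_two.pow_of_ne_zero (by omega)).sub_odd (by
        rcases hlam with rfl | rfl <;> decide)
    exact (Int.odd_pow' (by norm_num)).mp (Int.odd_mul.mp this).2
  have hmod : (D₁ : ℤ) % 8 = 7 := by
    obtain ⟨u, hu⟩ := Int.eight_dvd_sq_sub_one_of_odd hxodd
    obtain ⟨v, hv⟩ := Int.eight_dvd_sq_sub_one_of_odd hD₂k
    obtain ⟨l, rfl⟩ : ∃ l, n = l + 1 := ⟨n - 1, by omega⟩
    have : (D₁ : ℤ) = 8 * (2 ^ l - v - D₁ * u) - 1 := by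
      have e : (2 : ℤ) ^ (l + 1 + 2) = 8 * 2 ^ l := by ring
      linear_combination heq - D₁ * hu - hv + e
    omega
  obtain ⟨e, he, rfl, rfl⟩ : ∃ e, 1 ≤ e ∧ Z₁ = e + 2 ∧ lam = 1 := by
    obtain ⟨u, hu⟩ := Int.eight_dvd_sq_sub_one_of_odd hX₁odd
    have hD : (D₁ : ℤ) = 2 ^ Z₁ - lam - 8 * (D₁ * u) := by
      linear_combination h1 - D₁ * hu
    match Z₁ with
    | 1 => omega
    | 2 => omega
    | Z + 3 =>
      refine ⟨Z + 1, by omega, rfl, ?_⟩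
      rw [show (2 : ℤ) ^ (Z + 3) = 8 * 2 ^ Z by ring] at hD
      omega
  have hD₂' : (D₂ : ℤ) = 12 * 2 ^ e + 1 := by rw [h2]; ring
  have heq₁ : 1 ^ 2 + (D₁ : ℤ) * (X₁ : ℤ) ^ 2 = 2 ^ (e + 2) := by rw [h1]; ring
  classical
  have hex : ∃ s : ℕ, 1 ≤ s ∧ ∃ a b : ℤ, Odd a ∧ Odd b ∧ a ^ 2 + D₁ * b ^ 2 = 2 ^ (s + 2) :=
    ⟨e, he, 1, X₁, odd_one, hX₁odd, heq₁⟩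
  obtain ⟨hs, a, b₀, ha, hb₀, hab⟩ := Nat.find_spec hex
  have hmin : ∀ (n : ℕ) (a b : ℤ), 1 ≤ n → Odd a → Odd b →
      a ^ 2 + (D₁ : ℤ) * b ^ 2 = 2 ^ (n + 2) → Nat.find hex ≤ n :=
    fun n a b hn ha hb h => Nat.find_min' hex ⟨hn, a, b, ha, hb, h⟩
  generalize Nat.find hex = s at *
  obtain ⟨a₀, ha₀pos, ha₀, h₀⟩ :
      ∃ a₀ : ℤ, 0 < a₀ ∧ Odd a₀ ∧ a₀ ^ 2 + (D₁ : ℤ) * b₀ ^ 2 = 2 ^ (s + 2) := by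
    refine ⟨|a|, abs_pos.mpr ?_, odd_abs.mpr ha, by rwa [sq_abs]⟩
    rintro rfl
    simp at ha
  obtain ⟨t, σ, -, ht, rfl, hσ, -, hV, -⟩ := exists_eq_lucas_of_minimal hs (by omega) hDodd ha₀ hb₀
    h₀ hmin _ 1 X₁ he odd_one hX₁odd heq₁
  obtain ⟨r, σ', -, hr, -, hσ', -, hV', -⟩ := exists_eq_lucas_of_minimal hs (by omega) hDodd ha₀ hb₀
    h₀ hmin _ _ x hn hD₂k hxodd heq
  obtain ⟨rfl, hcase⟩ := minimal_of_lucasV_eq hs ht hmod (by omega) ha₀pos ha₀ hb₀ h₀ hmin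
    (by simpa using heq₁) (by rcases hσ with rfl | rfl <;> omega)
  have hV'' : lucasV 1 (2 ^ s) r = (D₂ : ℤ) ^ k ∨ lucasV 1 (2 ^ s) r = -(D₂ : ℤ) ^ k := by
    rcases hσ' with rfl | rfl
    · left; linarith
    · right; linarith
  rcases hcase with rfl | ⟨rfl, rfl⟩
  · rw [mul_one] at *
    rw [hD₂'] at hV''
    obtain rfl | rfl | hs3 : s = 1 ∨ s = 2 ∨ 3 ≤ s := by omega
    · norm_num at hV''
      exact lucasV_one_two_ne_pow hr hk hV''
    · norm_num at hV''
      exact lucasV_one_four_ne_pow hr hk hV''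
    · obtain rfl := eq_three_of_lucasV_eq_pow hs3 hr hk hV''
      norm_num at hD₂' h1
      apply hne
      have h31 : D₁ * X₁ ^ 2 = 31 := by exact_mod_cast h1
      have : D₁ ∣ 31 := Dvd.intro _ h31
      rcases (Nat.dvd_prime (by norm_num)).mp this with h | h
      · omega
      · rw [h, Prod.mk.injEq]
        exact ⟨rfl, by exact_mod_cast hD₂'⟩
  · norm_num at hD₂' hV''
    rw [hD₂'] at hV''
    have hmod16 : (193 : ℤ) ^ k % 16 = 1 := by
      have : (193 : ℤ) ^ k ≡ 1 ^ k [ZMOD 16] := Int.ModEq.pow k (by decide)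
      simpa [Int.ModEq] using this
    have hr2 : 2 ≤ r := by
      have : r ≠ 1 := by
        rintro rfl
        have : (1 : ℤ) < 193 ^ k := one_lt_pow₀ (by norm_num) (by omega)
        simp only [lucasV] at hV''
        omega
      omega
    obtain ⟨w, rfl⟩ := four_dvd_of_lucasV_one_two hr2 (by omega)
    rw [lucasV_mul] at hV''
    have h4 : lucasV 1 2 4 = 1 := by simp [lucasV]
    rw [h4] at hV''
    have := eq_three_of_lucasV_eq_pow (e := 4) (r := w) (by norm_num) (by omega) hk
      (by norm_num at hV'' ⊢; exact hV'')
    omega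
end

section
/- The equation 3·x² + 5^m = 2^(n+2) has exactly four solutions in positive integers (x,m,n), namely (1,1,1), (3,1,3), (1,3,5) and (13,1,7). -/
/-- The order `ℤ[β]` with `β² = -4 - β`, that is `β = (-1 + √-15) / 2`. -/
abbrev QuadOrder : Type := QuadraticAlgebra ℤ (-4) (-1)

namespace QuadOrder

/-- The generator `β = (-1 + √-15) / 2`. -/
def gen : QuadOrder := ⟨0, 1⟩

/-- The linear functional sending both `1` and `β` to `1`. -/
def coordSum (z : QuadOrder) : ℤ := z.re + z.im

lemma coordSum_add (z w : QuadOrder) : coordSum (z + w) = coordSum z + coordSum w := by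
  simp only [coordSum, QuadraticAlgebra.re_add, QuadraticAlgebra.im_add]
  ring

lemma coordSum_intCast_mul (c : ℤ) (z : QuadOrder) :
    coordSum ((c : QuadOrder) * z) = c * coordSum z := by
  simp only [coordSum, QuadraticAlgebra.re_mul, QuadraticAlgebra.im_mul,
    QuadraticAlgebra.re_intCast, QuadraticAlgebra.im_intCast]
  push_cast
  ring

end QuadOrder

open QuadOrder

/-- The odd-indexed terms of the Lehmer sequence attached to `(√3 + √-5) / 2`. -/
def lehmerOdd : ℕ → ℤ
  | 0 => 1
  | 1 => 1
  | t + 2 => -lehmerOdd (t + 1) - 4 * lehmerOdd t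

lemma lehmerOdd_add_two (t : ℕ) :
    lehmerOdd (t + 2) = -lehmerOdd (t + 1) - 4 * lehmerOdd t := rfl

lemma coordSum_gen_pow (t : ℕ) : coordSum (gen ^ t) = lehmerOdd t := by
  induction t using Nat.twoStepInduction with
  | zero => decide +kernel
  | one => decide +kernel
  | more t h0 h1 =>
    have hgen : gen ^ 2 = ((-1 : ℤ) : QuadOrder) * gen + ((-4 : ℤ) : QuadOrder) * 1 := by
      decide +kernel
    have hpow : gen ^ (t + 2) =
        ((-1 : ℤ) : QuadOrder) * gen ^ (t + 1) + ((-4 : ℤ) : QuadOrder) * gen ^ t := by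
      rw [pow_add, hgen]
      ring
    rw [hpow, coordSum_add, coordSum_intCast_mul, coordSum_intCast_mul, h0, h1,
      lehmerOdd_add_two]
    ring

lemma exists_one_add_pow_eq {R : Type*} [CommRing R] (y : R) (n : ℕ) :
    ∃ z, (1 + y) ^ n = 1 + n * y + y ^ 2 * z := by
  induction n with
  | zero => exact ⟨0, by simp⟩
  | succ n ih =>
    obtain ⟨z, hz⟩ := ih
    refine ⟨n + z + y * z, ?_⟩
    rw [pow_succ, hz]
    push_cast
    ring

/-- If `b ^ N` is `1 + p² c`, then `b ^ (N p ^ i)` is `1 + p ^ (i + 2) c` up to order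
`p ^ (i + 3)`. -/
lemma exists_pow_mul_pow_eq {R : Type*} [CommRing R] {b c : R} {N p : ℕ}
    (h : b ^ N = 1 + (p : R) ^ 2 * c) (i : ℕ) :
    ∃ d, b ^ (N * p ^ i) = 1 + (p : R) ^ (i + 2) * (c + p * d) := by
  induction i with
  | zero => exact ⟨0, by simpa using h⟩
  | succ i ih =>
    obtain ⟨d, hd⟩ := ih
    obtain ⟨z, hz⟩ := exists_one_add_pow_eq ((p : R) ^ (i + 2) * (c + p * d)) p
    refine ⟨d + (p : R) ^ i * (c + p * d) ^ 2 * z, ?_⟩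
    rw [pow_succ p, ← mul_assoc, pow_mul, hd, hz]
    ring

lemma exists_gen_pow_eq : ∃ c : QuadOrder, gen ^ 253 = 1 + ((23 : ℕ) : QuadOrder) ^ 2 * c :=
  ⟨⟨(gen ^ 253).re / 529, (gen ^ 253).im / 529⟩, by decide +kernel⟩

/-- A value of the sequence is not attained twice on a residue class modulo `253`, provided that
the difference of consecutive terms in this class is not divisible by `23 ^ 3`. -/
lemma eq_zero_of_lehmerOdd_eq {a s : ℕ}
    (hne : ¬ (23 ^ 3 : ℤ) ∣ lehmerOdd (a + 253) - lehmerOdd a)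
    (h : lehmerOdd (a + 253 * s) = lehmerOdd a) : s = 0 := by
  obtain ⟨c, hc⟩ := exists_gen_pow_eq
  have hdiff : lehmerOdd (a + 253) - lehmerOdd a = 23 ^ 2 * coordSum (gen ^ a * c) := by
    have hpow : gen ^ (a + 253) = gen ^ a + ((23 ^ 2 : ℤ) : QuadOrder) * (gen ^ a * c) := by
      rw [pow_add, hc]
      push_cast
      ring
    rw [← coordSum_gen_pow, ← coordSum_gen_pow, hpow, coordSum_add, coordSum_intCast_mul]
    ring
  have hunit : ¬ (23 : ℤ) ∣ coordSum (gen ^ a * c) := by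
    rintro ⟨k, hk⟩
    exact hne ⟨k, by rw [hdiff, hk]; ring⟩
  have hdvd : ∀ i : ℕ, 23 ^ i ∣ s := by
    intro i
    induction i with
    | zero => simp
    | succ i ih =>
      obtain ⟨r, rfl⟩ := ih
      obtain ⟨d, hd⟩ := exists_pow_mul_pow_eq hc i
      obtain ⟨z, hz⟩ :=
        exists_one_add_pow_eq (((23 : ℕ) : QuadOrder) ^ (i + 2) * (c + (23 : ℕ) * d)) r
      have hpow : gen ^ (a + 253 * (23 ^ i * r)) = gen ^ a + ((23 ^ (i + 2) : ℤ) : QuadOrder) *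
          (((r : ℤ) : QuadOrder) * (gen ^ a * c) + ((23 : ℤ) : QuadOrder) *
            (gen ^ a * (r * d + 23 ^ (i + 1) * (c + 23 * d) ^ 2 * z))) := by
        rw [pow_add, ← mul_assoc, pow_mul, hd, hz]
        push_cast
        ring
      rw [← coordSum_gen_pow, ← coordSum_gen_pow, hpow, coordSum_add, coordSum_intCast_mul,
        coordSum_add, coordSum_intCast_mul, coordSum_intCast_mul] at h
      have hzero := (mul_eq_zero.mp (left_eq_add.mp h.symm)).resolve_left (by positivity)
      have hprime : Prime (23 : ℤ) := by norm_num
      have hr : (23 : ℤ) ∣ r := by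
        refine (hprime.dvd_or_dvd ?_).resolve_right hunit
        exact ⟨_, by rw [eq_neg_of_add_eq_zero_left hzero, ← mul_neg]⟩
      rw [pow_succ]
      exact mul_dvd_mul_left _ (by exact_mod_cast hr)
  by_contra hs
  exact absurd (Nat.le_of_dvd (Nat.pos_of_ne_zero hs) (hdvd s))
    (not_le.mpr (Nat.lt_pow_self (by norm_num)))

lemma lehmerOdd_add_mul_modEq (r j : ℕ) :
    lehmerOdd (r + 253 * j) ≡ lehmerOdd r [ZMOD 529] := by
  obtain ⟨c, hc⟩ := exists_gen_pow_eq
  obtain ⟨z, hz⟩ := exists_one_add_pow_eq (((23 : ℕ) : QuadOrder) ^ 2 * c) j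
  have hpow : gen ^ (r + 253 * j) = gen ^ r + ((529 : ℤ) : QuadOrder) *
      (gen ^ r * (j * c + 529 * c ^ 2 * z)) := by
    rw [pow_add, pow_mul, hc, hz]
    push_cast
    ring
  rw [← coordSum_gen_pow, ← coordSum_gen_pow, hpow, coordSum_add, coordSum_intCast_mul]
  exact (Int.modEq_iff_dvd.mpr ⟨_, by rw [add_sub_cancel_left]⟩).symm

lemma eq_of_lehmerOdd_eq_one_or {t : ℕ} (h : lehmerOdd t = 1 ∨ lehmerOdd t = -1) :
    t = 0 ∨ t = 1 ∨ t = 3 := by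
  have table : ∀ r < 253, (lehmerOdd r - 1) % 529 = 0 ∨ (lehmerOdd r + 1) % 529 = 0 →
      r = 0 ∨ r = 1 ∨ r = 3 := by decide +kernel
  have hmod := lehmerOdd_add_mul_modEq (t % 253) (t / 253)
  rw [Nat.mod_add_div, Int.ModEq] at hmod
  have hr := table (t % 253) (Nat.mod_lt _ (by norm_num)) (by omega)
  have hval : lehmerOdd (t % 253) = 1 := by
    rcases hr with hr | hr | hr <;> rw [hr] <;> rfl
  have hs : t / 253 = 0 := by
    apply eq_zero_of_lehmerOdd_eq (a := t % 253)
    · rcases hr with hr | hr | hr <;> rw [hr] <;> decide +kernel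
    · rw [Nat.mod_add_div]
      omega
  omega

lemma eq_two_of_lehmerOdd_eq_five_or {t : ℕ} (h : lehmerOdd t = 5 ∨ lehmerOdd t = -5) :
    t = 2 := by
  have table : ∀ r < 253, (lehmerOdd r - 5) % 529 = 0 ∨ (lehmerOdd r + 5) % 529 = 0 →
      r = 2 := by decide +kernel
  have hmod := lehmerOdd_add_mul_modEq (t % 253) (t / 253)
  rw [Nat.mod_add_div, Int.ModEq] at hmod
  have hr := table (t % 253) (Nat.mod_lt _ (by norm_num)) (by omega)
  have hval : lehmerOdd (t % 253) = -5 := by rw [hr]; rfl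
  have hs : t / 253 = 0 := by
    apply eq_zero_of_lehmerOdd_eq (a := t % 253)
    · rw [hr]
      decide +kernel
    · rw [Nat.mod_add_div]
      omega
  omega

lemma lehmerOdd_add_twentyFive (t : ℕ) :
    lehmerOdd (t + 25) = 7524132 * lehmerOdd t + 17317525 * lehmerOdd (t + 1) := by
  induction t using Nat.twoStepInduction with
  | zero => decide +kernel
  | one => decide +kernel
  | more t h0 h1 =>
    rw [show t + 2 + 25 = t + 25 + 2 by ring, lehmerOdd_add_two (t + 25),
      show t + 25 + 1 = t + 1 + 25 by ring, h0, h1, lehmerOdd_add_two (t + 1),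
      lehmerOdd_add_two t]
    ring

/-- The prime `149` divides every term of the sequence that is divisible by `25`. -/
lemma dvd_lehmerOdd_of_twentyFive_dvd (t : ℕ) (h : (25 : ℤ) ∣ lehmerOdd t) :
    (149 : ℤ) ∣ lehmerOdd t := by
  induction t using Nat.strong_induction_on with
  | _ t ih =>
    by_cases ht : t < 25
    · have table : ∀ r < 25, (25 : ℤ) ∣ lehmerOdd r → (149 : ℤ) ∣ lehmerOdd r := by
        decide +kernel
      exact table t ht h
    · obtain ⟨r, rfl⟩ := Nat.exists_eq_add_of_le' (not_lt.mp ht)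
      have hrec := lehmerOdd_add_twentyFive r
      have := ih r (by omega) (by omega)
      omega

/-- Odd solutions of `3 x² + 5 y² = 2 ^ (2 t + 3)` come from powers of `(√3 + √-5) / 2`. -/
lemma exists_sign_lehmerOdd (t : ℕ) (x y : ℤ) (hy : y % 2 = 1) (hxy : (x - y) % 4 = 0)
    (h : 3 * x ^ 2 + 5 * y ^ 2 = 2 ^ (2 * t + 3)) :
    ∃ e : ℤ, (e = 1 ∨ e = -1) ∧ y = e * lehmerOdd t ∧
      3 * x - y = 2 * e * lehmerOdd (t + 1) := by
  induction t generalizing x y with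
  | zero =>
    norm_num at h
    have hx1 : x ≤ 1 := by nlinarith
    have hx2 : -1 ≤ x := by nlinarith
    have hy1 : y ≤ 1 := by nlinarith
    have hy2 : -1 ≤ y := by nlinarith
    have hyx : y = x := by omega
    refine ⟨y, by omega, ?_, ?_⟩ <;> (simp [lehmerOdd]; try omega)
  | succ t ih =>
    obtain ⟨v, hv⟩ : (4 : ℤ) ∣ x - y := Int.dvd_of_emod_eq_zero hxy
    obtain rfl : x = y + 4 * v := by omega
    have hsum : (y ^ 2 + 3 * v * y + 6 * v ^ 2) % 4 = 0 := by
      have hpow : (2 : ℤ) ^ (2 * (t + 1) + 3) = 32 * 2 ^ (2 * t) := by ring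
      have hexp : 3 * (y + 4 * v) ^ 2 + 5 * y ^ 2 = 8 * (y ^ 2 + 3 * v * y + 6 * v ^ 2) := by ring
      omega
    have hvy : (v + y) % 4 = 0 := by
      have hy4 : y % 4 = 1 ∨ y % 4 = 3 := by omega
      have hv4 : v % 4 = 0 ∨ v % 4 = 1 ∨ v % 4 = 2 ∨ v % 4 = 3 := by omega
      rcases hy4 with h1 | h1 <;> rcases hv4 with h2 | h2 | h2 | h2 <;>
        simp [pow_two, Int.add_emod, Int.mul_emod, h1, h2] at hsum ⊢
    obtain ⟨s, hs⟩ : (4 : ℤ) ∣ v + y := Int.dvd_of_emod_eq_zero hvy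
    obtain rfl : v = 4 * s - y := by omega
    obtain ⟨e, he, h1, h2⟩ := ih (y - 2 * s) (y - 6 * s) (by omega) (by omega) (by
      rw [show 2 * (t + 1) + 3 = 2 * t + 3 + 2 by ring, pow_add] at h
      linarith)
    refine ⟨e, he, ?_, ?_⟩
    · linarith
    · rw [lehmerOdd_add_two]
      linarith

lemma eq_of_three_mul_sq_add_five_pow {x m n : ℕ} (hm : 0 < m) (hn : 0 < n)
    (h : 3 * x ^ 2 + 5 ^ m = 2 ^ (n + 2)) :
    (x, m, n) = (1, 1, 1) ∨ (x, m, n) = (3, 1, 3) ∨ (x, m, n) = (1, 3, 5) ∨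
      (x, m, n) = (13, 1, 7) := by
  obtain ⟨k, hk⟩ : Odd m := by
    rw [← Nat.not_even_iff_odd]
    rintro ⟨k, rfl⟩
    obtain ⟨j, rfl⟩ := Nat.exists_eq_add_of_lt hn
    have h25 : 5 ^ (k + k) % 8 = 1 := by
      rw [← two_mul, pow_mul, Nat.pow_mod]
      simp
    have h2 : 2 ^ (0 + j + 1 + 2) = 8 * 2 ^ j := by ring
    have hx : x ^ 2 % 8 = 0 ∨ x ^ 2 % 8 = 1 ∨ x ^ 2 % 8 = 4 := by
      have : x % 8 < 8 := Nat.mod_lt _ (by norm_num)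
      rw [Nat.pow_mod]
      interval_cases x % 8 <;> simp
    rw [h2] at h
    generalize 5 ^ (k + k) = a at h h25
    generalize 2 ^ j = b at h
    omega
  subst hk
  obtain ⟨t, ht⟩ : Odd n := by
    rw [← Nat.not_even_iff_odd]
    rintro ⟨j, rfl⟩
    have h5 : 5 ^ (2 * k + 1) % 3 = 2 := by
      rw [pow_succ, pow_mul, Nat.mul_mod, Nat.pow_mod]
      simp
    have h2 : 2 ^ (j + j + 2) % 3 = 1 := by
      rw [show j + j + 2 = 2 * (j + 1) by ring, pow_mul, Nat.pow_mod]
      simp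
    generalize 5 ^ (2 * k + 1) = a at h h5
    generalize 2 ^ (j + j + 2) = b at h h2
    omega
  subst ht
  have h4 : 5 ^ k % 4 = 1 := by
    rw [Nat.pow_mod]
    simp
  have hx : x % 2 = 1 := by
    by_contra hx
    obtain ⟨w, rfl⟩ : 2 ∣ x := by omega
    have h5 : 5 ^ (2 * k + 1) % 2 = 1 := by
      rw [Nat.pow_mod]
      simp
    have h2 : 2 ^ (2 * t + 1 + 2) = 2 * 2 ^ (2 * t + 2) := by ring
    have hw : 3 * (2 * w) ^ 2 = 2 * (6 * w ^ 2) := by ring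
    rw [h2, hw] at h
    generalize 5 ^ (2 * k + 1) = a at h h5
    omega
  have hZ : 3 * (x : ℤ) ^ 2 + 5 * (5 ^ k) ^ 2 = 2 ^ (2 * t + 3) := by
    have hcast : (3 * (x : ℤ) ^ 2 + 5 ^ (2 * k + 1)) = 2 ^ (2 * t + 1 + 2) := by exact_mod_cast h
    rw [← hcast]
    ring
  have h4Z : (5 : ℤ) ^ k % 4 = 1 := by exact_mod_cast h4
  have hU : (5 : ℤ) ^ k = lehmerOdd t ∨ (5 : ℤ) ^ k = -lehmerOdd t := by
    obtain ⟨X, hX4, hX2⟩ : ∃ X : ℤ, X % 4 = 1 ∧ X ^ 2 = (x : ℤ) ^ 2 := by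
      rcases (by omega : x % 4 = 1 ∨ x % 4 = 3) with hx4 | hx4
      · exact ⟨x, by omega, rfl⟩
      · exact ⟨-x, by omega, neg_sq _⟩
    obtain ⟨e, rfl | rfl, he, -⟩ :=
      exists_sign_lehmerOdd t X (5 ^ k) (by omega) (by omega) (by rw [hX2, hZ])
    · left
      linarith
    · right
      linarith
  have hkt : (k = 0 ∧ (t = 0 ∨ t = 1 ∨ t = 3)) ∨ (k = 1 ∧ t = 2) := by
    match k, hU with
    | 0, hU => exact .inl ⟨rfl, eq_of_lehmerOdd_eq_one_or (by rw [pow_zero] at hU; omega)⟩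
    | 1, hU => exact .inr ⟨rfl, eq_two_of_lehmerOdd_eq_five_or (by rw [pow_one] at hU; omega)⟩
    | k + 2, hU =>
      exfalso
      have hpow : (5 : ℤ) ^ (k + 2) = 25 * 5 ^ k := by ring
      have h149 := dvd_lehmerOdd_of_twentyFive_dvd t (by omega)
      have hdvd : (149 : ℤ) ∣ 5 ^ (k + 2) := by omega
      have hprime : Prime (149 : ℤ) := by norm_num
      exact absurd (hprime.dvd_of_dvd_pow hdvd) (by norm_num)
  have hx13 : x ≤ 13 := by
    rcases hkt with ⟨rfl, rfl | rfl | rfl⟩ | ⟨rfl, rfl⟩ <;> norm_num at h <;> nlinarith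
  simp only [Prod.mk.injEq]
  rcases hkt with ⟨rfl, rfl | rfl | rfl⟩ | ⟨rfl, rfl⟩ <;> interval_cases x <;> simp_all


/-- The equation `3·x² + 5^m = 2^(n+2)` has exactly the four positive
solutions `(1,1,1)`, `(3,1,3)`, `(1,3,5)` and `(13,1,7)`. -/
theorem stmt_15 :
    {p : ℕ × ℕ × ℕ | 0 < p.1 ∧ 0 < p.2.1 ∧ 0 < p.2.2 ∧
        3 * p.1 ^ 2 + 5 ^ p.2.1 = 2 ^ (p.2.2 + 2)} =
      {(1, 1, 1), (3, 1, 3), (1, 3, 5), (13, 1, 7)} := by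
  ext ⟨x, m, n⟩
  simp only [Set.mem_ofPred_eq, Set.mem_insert_iff, Set.mem_singleton_iff]
  constructor
  · rintro ⟨-, hm, hn, h⟩
    exact eq_of_three_mul_sq_add_five_pow hm hn h
  · rintro (h | h | h | h) <;> obtain ⟨rfl, rfl, rfl⟩ := Prod.mk.injEq .. ▸ h <;> norm_num
end

section
/- The equation 5·x² + 3^m = 2^(n+2) has exactly four solutions in positive integers (x,m,n), namely (1,1,1), (1,3,3), (5,1,5) and (19,5,9). -/
/-- The sequence `1, 3, -1, -13, -9, …` of one third of the traces of
`(3 + √-15) / 2 * ((1 - √-15) / 2) ^ j`. -/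
def halfTrace : ℕ → ℤ
  | 0 => 1
  | 1 => 3
  | n + 2 => halfTrace (n + 1) - 4 * halfTrace n

theorem halfTrace_add_two (n : ℕ) :
    halfTrace (n + 2) = halfTrace (n + 1) - 4 * halfTrace n := by
  rw [halfTrace]

theorem odd_halfTrace (n : ℕ) : Odd (halfTrace n) := by
  induction n using Nat.twoStepInduction with
  | zero => decide
  | one => decide
  | more n _ ih =>
    rw [halfTrace_add_two]
    exact ih.sub_even ⟨2 * halfTrace n, by ring⟩

theorem halfTrace_add_modEq {m : ℤ} {i T : ℕ} (h₀ : halfTrace (i + T) ≡ halfTrace i [ZMOD m])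
    (h₁ : halfTrace (i + T + 1) ≡ halfTrace (i + 1) [ZMOD m]) (n : ℕ) :
    halfTrace (n + i + T) ≡ halfTrace (n + i) [ZMOD m] := by
  induction n using Nat.twoStepInduction with
  | zero => simpa using h₀
  | one => rwa [show 1 + i + T = i + T + 1 by ring, add_comm 1 i]
  | more n ih₀ ih₁ =>
    rw [show n + 2 + i + T = n + i + T + 2 by ring, show n + 2 + i = n + i + 2 by ring,
      halfTrace_add_two, halfTrace_add_two, show n + i + T + 1 = n + 1 + i + T by ring,
      show n + i + 1 = n + 1 + i by ring]
    exact ih₁.sub (ih₀.mul_left 4)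

/-- Beyond the index `i`, residues of `halfTrace` with period `T` are attained within one period. -/
theorem halfTrace_mod_modEq {m : ℤ} {i T : ℕ} (h₀ : halfTrace (i + T) ≡ halfTrace i [ZMOD m])
    (h₁ : halfTrace (i + T + 1) ≡ halfTrace (i + 1) [ZMOD m]) (n : ℕ) :
    halfTrace (n + i) ≡ halfTrace (n % T + i) [ZMOD m] := by
  have shift (r q : ℕ) : halfTrace (r + T * q + i) ≡ halfTrace (r + i) [ZMOD m] := by
    induction q with
    | zero => simp [Int.ModEq.refl]
    | succ q ih =>
      have := halfTrace_add_modEq h₀ h₁ (r + T * q)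
      rw [show r + T * (q + 1) + i = r + T * q + i + T by ring]
      exact this.trans ih
  simpa [Nat.mod_add_div] using shift (n % T) (n / T)

theorem pow_three_emod_2071 (l : ℕ) : (3 : ℤ) ^ l ≡ 3 ^ (l % 54) [ZMOD 2071] := by
  conv_lhs => rw [← Nat.mod_add_div l 54, pow_add, pow_mul]
  have h : (3 : ℤ) ^ 54 ≡ 1 [ZMOD 2071] := by decide
  simpa using (h.pow (l / 54)).mul_left (3 ^ (l % 54))

theorem halfTrace_period_54 : ∀ j < 54, ∀ l < 54, halfTrace j % 27 = 0 →
    halfTrace j % 2071 ≠ 3 ^ l % 2071 ∧ halfTrace j % 2071 ≠ -3 ^ l % 2071 := by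
  decide +kernel

theorem halfTrace_period_256 : ∀ j < 256, halfTrace (j + 5) % 263168 ∉
    ({1, 3, 9, -1 % 263168, -3 % 263168, -9 % 263168} : List ℤ) := by
  decide +kernel

theorem halfTrace_ne_of_three_le {l : ℕ} (hl : 3 ≤ l) (j : ℕ) :
    halfTrace j ≠ 3 ^ l ∧ halfTrace j ≠ -3 ^ l := by
  have key (m : ℤ) (h₀ : halfTrace 54 ≡ halfTrace 0 [ZMOD m])
      (h₁ : halfTrace 55 ≡ halfTrace 1 [ZMOD m]) :
      halfTrace j ≡ halfTrace (j % 54) [ZMOD m] :=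
    halfTrace_mod_modEq (i := 0) (T := 54) h₀ h₁ j
  have h27 := key 27 (by decide +kernel) (by decide +kernel)
  have h2071 := key 2071 (by decide +kernel) (by decide +kernel)
  have h3 := pow_three_emod_2071 l
  have dvd : (27 : ℤ) ∣ 3 ^ l := pow_dvd_pow (3 : ℤ) hl
  have fin := halfTrace_period_54 (j % 54) (Nat.mod_lt _ (by norm_num)) (l % 54)
    (Nat.mod_lt _ (by norm_num))
  refine ⟨fun h => ?_, fun h => ?_⟩
  · rw [h] at h27 h2071
    exact (fin (h27.symm.trans (Int.modEq_zero_iff_dvd.2 dvd))).1 (h2071.symm.trans h3)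
  · rw [h] at h27 h2071
    exact (fin (h27.symm.trans (Int.modEq_zero_iff_dvd.2 dvd.neg_right))).2
      (h2071.symm.trans h3.neg)

theorem halfTrace_ne_of_five_le {j : ℕ} (hj : 5 ≤ j) {l : ℕ} (hl : l < 3) :
    halfTrace j ≠ 3 ^ l ∧ halfTrace j ≠ -3 ^ l := by
  obtain ⟨k, rfl⟩ := Nat.exists_eq_add_of_le' hj
  have h := halfTrace_mod_modEq (m := 263168) (i := 5) (T := 256)
    (by decide +kernel) (by decide +kernel) k
  have fin := halfTrace_period_256 (k % 256) (Nat.mod_lt _ (by norm_num))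
  rw [← h] at fin
  refine ⟨fun e => fin ?_, fun e => fin ?_⟩ <;> rw [e] <;> interval_cases l <;> decide

theorem eq_of_halfTrace_eq {j l : ℕ} (h : halfTrace j = 3 ^ l ∨ halfTrace j = -3 ^ l) :
    j = 0 ∧ l = 0 ∨ j = 1 ∧ l = 1 ∨ j = 2 ∧ l = 0 ∨ j = 4 ∧ l = 2 := by
  have hl : l < 3 := by
    by_contra! hl
    exact h.elim (halfTrace_ne_of_three_le hl j).1 (halfTrace_ne_of_three_le hl j).2
  have hj : j < 5 := by
    by_contra! hj
    exact h.elim (halfTrace_ne_of_five_le hj hl).1 (halfTrace_ne_of_five_le hj hl).2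
  revert h
  interval_cases j <;> interval_cases l <;> decide

/-- One of `y - 3 * x`, `y + 3 * x` is divisible by `16`. -/
theorem sixteen_dvd_of_odd {x y : ℤ} (hx : Odd x) (hy : Odd y)
    (h : 32 ∣ 3 * y ^ 2 + 5 * x ^ 2) : 16 ∣ y - 3 * x ∨ 16 ∣ y + 3 * x := by
  obtain ⟨a, rfl⟩ := hy
  obtain ⟨b, rfl⟩ := hx
  have key : (2 : ℤ) ^ 3 ∣ (a - 3 * b - 1) * (a + 3 * b + 2) := by
    have e : 3 * (2 * a + 1) ^ 2 + 5 * (2 * b + 1) ^ 2 =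
        12 * ((a - 3 * b - 1) * (a + 3 * b + 2)) + 32 * (2 * b + 1) ^ 2 := by ring
    omega
  have coprime {c : ℤ} (hc : Odd c) : IsCoprime ((2 : ℤ) ^ 3) c :=
    (Int.isCoprime_two_left.2 hc).pow_left
  rcases Int.even_or_odd (a - 3 * b - 1) with he | ho
  · have ho : Odd (a + 3 * b + 2) := by
      obtain ⟨c, hc⟩ := he
      exact ⟨c + 3 * b + 1, by omega⟩
    have := (coprime ho).dvd_of_dvd_mul_right key
    left
    omega
  · have := (coprime ho).dvd_of_dvd_mul_left key
    right
    omega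

theorem eq_halfTrace_of_odd (j : ℕ) : ∀ x y : ℤ, Odd x → Odd y →
    3 * y ^ 2 + 5 * x ^ 2 = 2 ^ (2 * j + 3) →
      (y = halfTrace j ∨ y = -halfTrace j) ∧
      (5 * x = 2 * halfTrace (j + 1) - halfTrace j ∨
        5 * x = -(2 * halfTrace (j + 1) - halfTrace j)) := by
  induction j with
  | zero =>
    intro x y hx hy h
    norm_num at h
    have hx1 : x ^ 2 < 2 ^ 2 := by nlinarith [sq_nonneg y]
    have hy1 : y ^ 2 < 2 ^ 2 := by nlinarith [sq_nonneg x]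
    have := abs_lt_of_sq_lt_sq hx1 (by norm_num)
    have := abs_lt_of_sq_lt_sq hy1 (by norm_num)
    obtain ⟨a, rfl⟩ := hx
    obtain ⟨b, rfl⟩ := hy
    simp only [halfTrace, abs_lt] at *
    omega
  | succ j ih =>
    have aux (x y : ℤ) (hx : Odd x) (h : 3 * y ^ 2 + 5 * x ^ 2 = 2 ^ (2 * (j + 1) + 3))
        (hd : 16 ∣ y - 3 * x) : (y = halfTrace (j + 1) ∨ y = -halfTrace (j + 1)) ∧
          (5 * x = 2 * halfTrace (j + 1 + 1) - halfTrace (j + 1) ∨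
            5 * x = -(2 * halfTrace (j + 1 + 1) - halfTrace (j + 1))) := by
      obtain ⟨k, hk⟩ := hd
      obtain rfl : y = 3 * x + 16 * k := by omega
      have descent := ih (-x - 6 * k) (x + 2 * k)
        (hx.neg.sub_even ⟨3 * k, by ring⟩) (hx.add_even ⟨k, by ring⟩)
        (by rw [show 2 * (j + 1) + 3 = 2 * j + 3 + 2 by ring, pow_add] at h; linarith)
      obtain ⟨c, hc⟩ := odd_halfTrace j
      obtain ⟨d, hd⟩ := odd_halfTrace (j + 1)
      obtain ⟨e, he⟩ := hx
      rw [halfTrace_add_two]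
      omega
    intro x y hx hy h
    have h32 : 32 ∣ 3 * y ^ 2 + 5 * x ^ 2 :=
      h ▸ pow_dvd_pow (2 : ℤ) (show 5 ≤ 2 * (j + 1) + 3 by omega)
    rcases sixteen_dvd_of_odd hx hy h32 with hd | hd
    · exact aux x y hx h hd
    · have := aux (-x) y hx.neg (by rw [neg_sq, h]) (by simpa using hd)
      omega

theorem odd_of_five_mul_sq_add {x m n : ℕ} (hn : 0 < n)
    (h : 5 * x ^ 2 + 3 ^ m = 2 ^ (n + 2)) : Odd x ∧ Odd m ∧ Odd n := by
  have h8 : 8 ∣ 2 ^ (n + 2) := pow_dvd_pow 2 (show 3 ≤ n + 2 by omega)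
  have hodd : Odd (3 ^ m) := Odd.pow (by decide)
  have hx : Odd x := by
    by_contra hx
    obtain ⟨a, rfl⟩ := Nat.not_odd_iff_even.1 hx
    obtain ⟨b, hb⟩ := hodd
    ring_nf at h h8 hb
    omega
  have hm : Odd m := by
    by_contra hm
    obtain ⟨a, rfl⟩ := Nat.not_odd_iff_even.1 hm
    have h9 : 3 ^ (a + a) % 8 = 1 := by
      rw [← two_mul, pow_mul, Nat.pow_mod]
      norm_num
    have hx8 : x ^ 2 % 8 = 1 := by
      have h2 := Nat.odd_iff.1 hx
      rw [Nat.pow_mod]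
      have : x % 8 = 1 ∨ x % 8 = 3 ∨ x % 8 = 5 ∨ x % 8 = 7 := by omega
      rcases this with e | e | e | e <;> rw [e]
    omega
  refine ⟨hx, hm, ?_⟩
  by_contra hn'
  obtain ⟨a, rfl⟩ := Nat.not_odd_iff_even.1 hn'
  have h4 : 2 ^ (a + a + 2) % 3 = 1 := by
    rw [show a + a + 2 = 2 * (a + 1) by ring, pow_mul, Nat.pow_mod]
    norm_num
  have h3 : 3 ∣ 3 ^ m := dvd_pow_self 3 hm.pos.ne'
  have hx3 : x ^ 2 % 3 = 0 ∨ x ^ 2 % 3 = 1 := by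
    have : x % 3 < 3 := Nat.mod_lt _ (by norm_num)
    rw [Nat.pow_mod]
    interval_cases x % 3 <;> simp
  omega

/-- The equation `5·x² + 3^m = 2^(n+2)` has exactly the four positive
solutions `(1,1,1)`, `(1,3,3)`, `(5,1,5)` and `(19,5,9)`. -/
theorem stmt_16 :
    {p : ℕ × ℕ × ℕ | 0 < p.1 ∧ 0 < p.2.1 ∧ 0 < p.2.2 ∧
        5 * p.1 ^ 2 + 3 ^ p.2.1 = 2 ^ (p.2.2 + 2)} =
      {(1, 1, 1), (1, 3, 3), (5, 1, 5), (19, 5, 9)} := by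
  ext ⟨x, m, n⟩
  simp only [Set.mem_ofPred_eq, Set.mem_insert_iff, Set.mem_singleton_iff, Prod.mk.injEq]
  constructor
  · rintro ⟨-, -, hn, h⟩
    obtain ⟨hx, ⟨l, rfl⟩, ⟨j, rfl⟩⟩ := odd_of_five_mul_sq_add hn h
    have hz : 3 * ((3 : ℤ) ^ l) ^ 2 + 5 * (x : ℤ) ^ 2 = 2 ^ (2 * j + 3) := by
      have : 5 * (x : ℤ) ^ 2 + 3 ^ (2 * l + 1) = 2 ^ (2 * j + 1 + 2) := by exact_mod_cast h
      rw [← this]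
      ring
    have hl := (eq_halfTrace_of_odd j x (3 ^ l) (by exact_mod_cast hx)
      (Odd.pow (by decide)) hz).1
    have sq_eq {c : ℕ} (hc : x ^ 2 = c ^ 2) : x = c :=
      Nat.pow_left_injective two_ne_zero hc
    rcases eq_of_halfTrace_eq (hl.imp Eq.symm fun e => by rw [e, neg_neg]) with
      ⟨rfl, rfl⟩ | ⟨rfl, rfl⟩ | ⟨rfl, rfl⟩ | ⟨rfl, rfl⟩
    · exact Or.inl ⟨sq_eq (by omega), rfl, rfl⟩
    · exact Or.inr (Or.inl ⟨sq_eq (by omega), rfl, rfl⟩)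
    · exact Or.inr (Or.inr (Or.inl ⟨sq_eq (by omega), rfl, rfl⟩))
    · exact Or.inr (Or.inr (Or.inr ⟨sq_eq (by omega), rfl, rfl⟩))
  · rintro (⟨rfl, rfl, rfl⟩ | ⟨rfl, rfl, rfl⟩ | ⟨rfl, rfl, rfl⟩ | ⟨rfl, rfl, rfl⟩) <;> norm_num
end

section
/- The equation 13·x² + 3^m = 2^(n+2) has exactly three solutions in positive integers (x,m,n), namely (1,1,2), (1,5,6) and (71,1,14). -/
/-- Multiplication by `649 + 180√13`, the fundamental solution of `c² - 13 d² = 1`,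
on coordinates modulo `196096 = 512 * 383`. -/
def pellStepMod (p : ℕ × ℕ) : ℕ × ℕ :=
  ((649 * p.1 + 2340 * p.2) % 196096, (180 * p.1 + 649 * p.2) % 196096)

theorem no_small_pell_thirteen (d : ℕ) (hd : 0 < d) (hd' : d < 180) (c : ℕ) :
    c ^ 2 ≠ 13 * d ^ 2 + 1 := by
  intro h
  have key : ∀ d < 180, 0 < d → Nat.sqrt (13 * d ^ 2 + 1) ^ 2 ≠ 13 * d ^ 2 + 1 := by
    decide +kernel
  apply key d hd' hd
  rw [← h, Nat.sqrt_eq']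

theorem pell_thirteen_residues (d : ℕ) : ∀ c : ℕ, c ^ 2 = 13 * d ^ 2 + 1 →
    ∃ i : ℕ, (c % 196096, d % 196096) = pellStepMod^[i] (1, 0) := by
  induction d using Nat.strong_induction_on with
  | _ d ih =>
    intro c h
    rcases Nat.eq_zero_or_pos d with rfl | hd
    · have : c = 1 := by nlinarith
      exact ⟨0, by simp [this]⟩
    have hd' : 180 ≤ d := by
      by_contra hlt
      exact no_small_pell_thirteen d hd (by omega) c h
    have h₁ : 180 * c ≤ 649 * d := by
      apply (Nat.pow_le_pow_iff_left (n := 2) (by norm_num)).mp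
      nlinarith
    have h₂ : 649 * d < d + 180 * c := by
      suffices 18 * d < 5 * c by omega
      apply lt_of_pow_lt_pow_left₀ 2 (by positivity)
      nlinarith
    have h₃ : 2340 * d ≤ 649 * c := by
      apply (Nat.pow_le_pow_iff_left (n := 2) (by norm_num)).mp
      nlinarith
    obtain ⟨c', hc'⟩ := Nat.exists_eq_add_of_le h₃
    obtain ⟨d', hd''⟩ := Nat.exists_eq_add_of_le h₁
    have hc : c = 649 * c' + 2340 * d' := by omega
    have hdd : d = 180 * c' + 649 * d' := by omega
    obtain ⟨i, hi⟩ := ih d' (by omega) c' (by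
      zify at h hc hdd ⊢
      rw [hc, hdd] at h
      linear_combination h)
    refine ⟨i + 1, ?_⟩
    rw [Function.iterate_succ_apply', ← hi, pellStepMod]
    ext <;> simp only [hc, hdd] <;> omega

theorem pellStepMod_orbit (i : ℕ) :
    let p := pellStepMod^[i] (1, 0)
    ((4 * p.1 + 13 * p.2) % 512 = 0 → (4 * p.1 + 13 * p.2) % 383 = 127) ∧
    ((4 * p.1 + 13 * (196096 - p.2)) % 512 = 0 →
      (4 * p.1 + 13 * (196096 - p.2)) % 383 = 127) := by
  have hper : Function.IsPeriodicPt pellStepMod 128 (1, 0) := by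
    change pellStepMod^[128] (1, 0) = (1, 0)
    decide +kernel
  have key : ∀ i < 128, let p := pellStepMod^[i] (1, 0)
      ((4 * p.1 + 13 * p.2) % 512 = 0 → (4 * p.1 + 13 * p.2) % 383 = 127) ∧
      ((4 * p.1 + 13 * (196096 - p.2)) % 512 = 0 →
        (4 * p.1 + 13 * (196096 - p.2)) % 383 = 127) := by
    decide +kernel
  rw [← hper.iterate_mod_apply i]
  exact key _ (Nat.mod_lt _ (by norm_num))

theorem exists_pell_one_of_pell_three (x y : ℕ) (h : 13 * x ^ 2 + 3 = y ^ 2) :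
    ∃ c d : ℕ, c ^ 2 = 13 * d ^ 2 + 1 ∧ (y = 4 * c + 13 * d ∨ y + 13 * d = 4 * c) := by
  have h3 : ((x : ℤ) - y) * (x + y) % 3 = 0 := by
    zify at h
    have : ((x : ℤ) - y) * (x + y) = 3 * (-4 * x ^ 2 - 1) := by linear_combination h
    omega
  obtain ⟨e, he, hey⟩ : ∃ e : ℤ, e ^ 2 = x ^ 2 ∧ (3 : ℤ) ∣ y - e := by
    rcases Int.prime_three.dvd_or_dvd (Int.dvd_of_emod_eq_zero h3) with h' | h'
    · exact ⟨x, rfl, by omega⟩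
    · exact ⟨-x, by ring, by omega⟩
  obtain ⟨f, hf⟩ := hey
  have hy' : (y : ℤ) = 3 * f + e := by omega
  have hpell : (4 * f - 3 * e) ^ 2 = 13 * (e - f) ^ 2 + 1 := by
    zify at h
    rw [← he, hy'] at h
    nlinarith
  have hc : 0 ≤ 4 * f - 3 * e := by
    have : (13 * e) ^ 2 ≤ (4 * (y : ℤ)) ^ 2 := by
      zify at h
      nlinarith [sq_nonneg e]
    have := (abs_le_of_sq_le_sq' this (by positivity)).2
    omega
  have hyc : (y : ℤ) = 4 * (4 * f - 3 * e) + 13 * (e - f) := by omega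
  refine ⟨(4 * f - 3 * e).natAbs, (e - f).natAbs, ?_, ?_⟩
  · zify
    rwa [sq_abs, sq_abs]
  · clear hpell h h3 he
    omega

/-- A solution of `y² - 13 x² = 3` with `512 ∣ y` satisfies `y ≡ -256 (mod 383)`. -/
theorem mod_383_of_pell_three (x y : ℕ) (h : 13 * x ^ 2 + 3 = y ^ 2) (hy : y % 512 = 0) :
    y % 383 = 127 := by
  obtain ⟨c, d, hcd, hyc⟩ := exists_pell_one_of_pell_three x y h
  obtain ⟨i, hi⟩ := pell_thirteen_residues d c hcd
  obtain ⟨h₁, h₂⟩ := pellStepMod_orbit i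
  rw [← hi] at h₁ h₂
  dsimp only at h₁ h₂
  have hc := Nat.mod_add_div c 196096
  have hd := Nat.mod_add_div d 196096
  have hd' := Nat.mod_lt d (show 196096 > 0 by norm_num)
  generalize c % 196096 = c₁ at *
  generalize d % 196096 = d₁ at *
  generalize c / 196096 = q at *
  generalize d / 196096 = r at *
  clear hi hcd h
  subst hc hd
  rcases hyc with hyc | hyc
  · have e₁ : y = 4 * c₁ + 13 * d₁ + 512 * (383 * (4 * q + 13 * r)) := by omega
    have := h₁ (by omega)
    omega
  · have e₁ : y + 512 * (383 * (13 * (r + 1))) =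
        4 * c₁ + 13 * (196096 - d₁) + 512 * (383 * (4 * q)) := by omega
    generalize 4 * c₁ + 13 * (196096 - d₁) = z at *
    have := h₂ (by omega)
    omega

theorem thirteen_sq_add_three (x j : ℕ) (h : 13 * x ^ 2 + 3 = 2 ^ (4 * j + 4)) :
    (x = 1 ∧ j = 0) ∨ (x = 71 ∧ j = 3) := by
  by_cases hj : j < 4
  · interval_cases j
    · left
      have : x ^ 2 = 1 ^ 2 := by omega
      exact ⟨Nat.pow_left_injective (n := 2) (by norm_num) this, rfl⟩
    · omega
    · omega
    · right
      have : x ^ 2 = 71 ^ 2 := by omega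
      exact ⟨Nat.pow_left_injective (n := 2) (by norm_num) this, rfl⟩
  exfalso
  have hmod := mod_383_of_pell_three x (2 ^ (2 * j + 2)) (by rw [h, ← pow_mul]; ring_nf) (by
    obtain ⟨i, rfl⟩ := Nat.exists_eq_add_of_le (not_lt.mp hj)
    rw [show 2 * (4 + i) + 2 = 9 + (2 * i + 1) by ring, pow_add]
    omega)
  have hsq : ∀ a < 383, a * a % 383 ≠ 127 := by decide +kernel
  apply hsq (2 ^ (j + 1) % 383) (Nat.mod_lt _ (by norm_num))
  rw [← Nat.mul_mod, ← hmod, ← pow_add]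
  ring_nf

/-- The pairs `(a, b)` with `((√3 + √-13) / 2) ^ (2 * j + 1) = (a√3 + b√-13) / 2`. -/
def lehmerPair : ℕ → ℤ × ℤ
  | 0 => (1, 1)
  | j + 1 => ((-5 * (lehmerPair j).1 - 13 * (lehmerPair j).2) / 2,
      (3 * (lehmerPair j).1 - 5 * (lehmerPair j).2) / 2)

theorem lehmerPair_odd (j : ℕ) :
    (lehmerPair j).1 % 2 = 1 ∧ (lehmerPair j).2 % 2 = 1 ∧
      (13 * (lehmerPair j).2 - 5 * (lehmerPair j).1) % 8 = 0 := by
  induction j with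
  | zero => simp [lehmerPair]
  | succ j ih => simp only [lehmerPair]; omega

theorem two_mul_lehmerPair_succ (j : ℕ) :
    2 * (lehmerPair (j + 1)).1 = -5 * (lehmerPair j).1 - 13 * (lehmerPair j).2 ∧
      2 * (lehmerPair (j + 1)).2 = 3 * (lehmerPair j).1 - 5 * (lehmerPair j).2 := by
  have := lehmerPair_odd j
  simp only [lehmerPair]
  omega

theorem lehmerPair_norm (j : ℕ) :
    3 * (lehmerPair j).1 ^ 2 + 13 * (lehmerPair j).2 ^ 2 = 16 * 16 ^ j := by
  induction j with
  | zero => simp [lehmerPair]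
  | succ j ih =>
    obtain ⟨h₁, h₂⟩ := two_mul_lehmerPair_succ j
    have h₃ := congrArg (· ^ 2) h₁
    have h₄ := congrArg (· ^ 2) h₂
    simp only [mul_pow] at h₃ h₄
    rw [pow_succ (16 : ℤ)]
    linarith

theorem lehmerPair_add_three (j : ℕ) :
    8 * (lehmerPair (j + 3)).1 = 460 * (lehmerPair j).1 - 468 * (lehmerPair j).2 ∧
      8 * (lehmerPair (j + 3)).2 = 108 * (lehmerPair j).1 + 460 * (lehmerPair j).2 := by
  have h₁ := two_mul_lehmerPair_succ j
  have h₂ := two_mul_lehmerPair_succ (j + 1)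
  have h₃ := two_mul_lehmerPair_succ (j + 2)
  simp only [add_assoc, Nat.reduceAdd] at h₂ h₃
  omega

theorem four_mul_lehmerPair_triple (i : ℕ) :
    4 * (lehmerPair (3 * i + 1)).1 =
        3 * (lehmerPair i).1 ^ 3 - 39 * (lehmerPair i).1 * (lehmerPair i).2 ^ 2 ∧
      4 * (lehmerPair (3 * i + 1)).2 =
        9 * (lehmerPair i).1 ^ 2 * (lehmerPair i).2 - 13 * (lehmerPair i).2 ^ 3 := by
  induction i with
  | zero => decide
  | succ i ih =>
    obtain ⟨h₁, h₂⟩ := two_mul_lehmerPair_succ i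
    obtain ⟨h₃, h₄⟩ := lehmerPair_add_three (3 * i + 1)
    obtain ⟨h₅, h₆⟩ := ih
    rw [show 3 * (i + 1) + 1 = 3 * i + 1 + 3 by ring]
    have h₇ : ∀ a b c d : ℤ, 2 * a = c → 2 * b = d →
        8 * (3 * a ^ 3 - 39 * a * b ^ 2) = 3 * c ^ 3 - 39 * c * d ^ 2 ∧
        8 * (9 * a ^ 2 * b - 13 * b ^ 3) = 9 * c ^ 2 * d - 13 * d ^ 3 := by
      rintro a b _ _ rfl rfl
      constructor <;> ring
    obtain ⟨h₈, h₉⟩ := h₇ _ _ _ _ h₁ h₂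
    constructor <;> linarith

theorem lehmerPair_triple (i : ℕ) :
    (lehmerPair (3 * i + 1)).1 =
      3 * ((lehmerPair i).1 * ((lehmerPair i).1 ^ 2 - 4 * 16 ^ i)) := by
  have h₁ := (four_mul_lehmerPair_triple i).1
  have h₂ := lehmerPair_norm i
  apply mul_left_cancel₀ (four_ne_zero (α := ℤ))
  linear_combination h₁ - 3 * (lehmerPair i).1 * h₂

theorem three_dvd_lehmerPair (j : ℕ) (h : (3 : ℤ) ∣ (lehmerPair j).1) : j % 3 = 1 := by
  have key : ∀ i, ((lehmerPair (3 * i)).1 % 3 = 1 ∨ (lehmerPair (3 * i)).1 % 3 = 2) ∧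
      ((lehmerPair (3 * i)).2 - (lehmerPair (3 * i)).1) % 3 = 0 := by
    intro i
    induction i with
    | zero => decide
    | succ i ih =>
      have := lehmerPair_add_three (3 * i)
      rw [show 3 * (i + 1) = 3 * i + 3 by ring]
      omega
  have hk := key (j / 3)
  have h₁ := two_mul_lehmerPair_succ (3 * (j / 3))
  have h₂ := two_mul_lehmerPair_succ (3 * (j / 3) + 1)
  by_contra hne
  obtain hj | hj : j = 3 * (j / 3) ∨ j = 3 * (j / 3) + 1 + 1 := by omega
  all_goals
    rw [hj] at h
    omega

theorem exists_descent (j : ℕ) (a b : ℤ) (ha : a % 2 = 1) (hb : b % 2 = 1)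
    (h : 3 * a ^ 2 + 13 * b ^ 2 = 16 * 16 ^ (j + 1)) (h32 : (13 * b - 5 * a) % 32 = 0) :
    ∃ a' b' : ℤ, (a' % 2 = 1 ∧ b' % 2 = 1) ∧ 3 * a' ^ 2 + 13 * b' ^ 2 = 16 * 16 ^ j ∧
      2 * a = -5 * a' - 13 * b' ∧ 2 * b = 3 * a' - 5 * b' := by
  obtain ⟨a', ha'⟩ : ∃ a', 13 * b - 5 * a = 32 * a' := Int.dvd_of_emod_eq_zero h32
  obtain ⟨b', hb'⟩ : ∃ b', -3 * a - 5 * b = 32 * b' :=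
    Int.dvd_of_emod_eq_zero (by omega)
  have h₁ : 2 * a = -5 * a' - 13 * b' := by omega
  have h₂ : 2 * b = 3 * a' - 5 * b' := by omega
  have h₀ : 3 * a' ^ 2 + 13 * b' ^ 2 = 16 * 16 ^ j := by
    rw [pow_succ (16 : ℤ)] at h
    have h₃ := congrArg (· ^ 2) h₁
    have h₄ := congrArg (· ^ 2) h₂
    simp only [mul_pow] at h₃ h₄
    linarith
  refine ⟨a', b', ?_, h₀, h₁, h₂⟩
  have hab : (a' - b') % 2 = 0 := by omega
  by_contra hcon
  obtain ⟨u, rfl⟩ : ∃ u, a' = 2 * u := Int.dvd_of_emod_eq_zero (by omega)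
  obtain ⟨v, rfl⟩ : ∃ v, b' = 2 * v := Int.dvd_of_emod_eq_zero (by omega)
  have huv : (u - v) % 2 = 1 := by omega
  have h₆ : (u - v) * (u + v) % 2 = 1 := by
    rw [Int.mul_emod, huv, show (u + v) % 2 = 1 by omega]; rfl
  have h₇ : (u - v) * (u + v) = 4 * 16 ^ j - 2 * u ^ 2 - 14 * v ^ 2 := by
    linarith
  omega

theorem thirtytwo_dvd_or (j : ℕ) (a b : ℤ) (ha : a % 2 = 1) (hb : b % 2 = 1)
    (h : 3 * a ^ 2 + 13 * b ^ 2 = 16 * 16 ^ (j + 1)) :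
    (13 * b - 5 * a) % 32 = 0 ∨ (13 * b + 5 * a) % 32 = 0 := by
  have hprod : (13 * b - 5 * a) * (13 * b + 5 * a) % 64 = 0 := by
    rw [pow_succ (16 : ℤ)] at h
    have : (13 * b - 5 * a) * (13 * b + 5 * a) = 64 * (52 * 16 ^ j - a ^ 2) := by
      linear_combination 13 * h
    omega
  obtain ⟨u, hu⟩ : ∃ u, 13 * b - 5 * a = 2 * u := Int.dvd_of_emod_eq_zero (by omega)
  obtain ⟨v, hv⟩ : ∃ v, 13 * b + 5 * a = 2 * v := Int.dvd_of_emod_eq_zero (by omega)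
  have huv : (2 : ℤ) ^ 4 ∣ u * v := by
    rw [hu, hv, show 2 * u * (2 * v) = 4 * (u * v) by ring] at hprod
    omega
  rcases Int.emod_two_eq_zero_or_one u with hu2 | hu2
  · have hcop : IsCoprime ((2 : ℤ) ^ 4) v := by
      apply IsCoprime.pow_left
      exact ⟨-(v / 2), 1, by omega⟩
    have := hcop.dvd_of_dvd_mul_right huv
    left; omega
  · have hcop : IsCoprime ((2 : ℤ) ^ 4) u := by
      apply IsCoprime.pow_left
      exact ⟨-(u / 2), 1, by omega⟩
    have := hcop.dvd_of_dvd_mul_left huv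
    right; omega

/-- Odd solutions of `3 a² + 13 b² = 16 ^ (j + 1)` are given by `lehmerPair`. -/
theorem eq_lehmerPair (j : ℕ) : ∀ a b : ℤ, a % 2 = 1 → b % 2 = 1 →
    3 * a ^ 2 + 13 * b ^ 2 = 16 * 16 ^ j →
    (a = (lehmerPair j).1 ∨ a = -(lehmerPair j).1) ∧
      (b = (lehmerPair j).2 ∨ b = -(lehmerPair j).2) := by
  induction j with
  | zero =>
    intro a b ha hb h
    simp only [lehmerPair]
    have h₁ : a ^ 2 = 1 ^ 2 := by
      have : 0 < b ^ 2 := by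
        have : b ≠ 0 := by omega
        positivity
      have : 0 < a ^ 2 := by
        have : a ≠ 0 := by omega
        positivity
      omega
    have h₂ : b ^ 2 = 1 ^ 2 := by omega
    exact ⟨sq_eq_sq_iff_eq_or_eq_neg.mp h₁, sq_eq_sq_iff_eq_or_eq_neg.mp h₂⟩
  | succ j ih =>
    intro a b ha hb h
    have main : ∀ a b : ℤ, a % 2 = 1 → b % 2 = 1 →
        3 * a ^ 2 + 13 * b ^ 2 = 16 * 16 ^ (j + 1) → (13 * b - 5 * a) % 32 = 0 →
        (a = (lehmerPair (j + 1)).1 ∨ a = -(lehmerPair (j + 1)).1) ∧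
          (b = (lehmerPair (j + 1)).2 ∨ b = -(lehmerPair (j + 1)).2) := by
      intro a b ha hb h h32
      obtain ⟨a', b', hpar, h₀, h₃, h₄⟩ := exists_descent j a b ha hb h h32
      obtain ⟨h₈, h₉⟩ := ih a' b' hpar.1 hpar.2 h₀
      obtain ⟨h₁, h₂⟩ := two_mul_lehmerPair_succ j
      obtain ⟨k, hk⟩ := Int.dvd_of_emod_eq_zero (lehmerPair_odd j).2.2
      rcases h₈ with rfl | rfl <;> rcases h₉ with rfl | rfl
      · exact ⟨.inl (by linarith), .inl (by linarith)⟩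
      · have : a = 2 * (2 * k) := by linarith
        exact absurd ha (by simp [this])
      · have : a = 2 * (-2 * k) := by linarith
        exact absurd ha (by simp [this])
      · exact ⟨.inr (by linarith), .inr (by linarith)⟩
    rcases thirtytwo_dvd_or j a b ha hb h with h32 | h32
    · exact main a b ha hb h h32
    · obtain ⟨h₁, h₂⟩ := main (-a) b (by omega) hb (by rwa [neg_sq]) (by omega)
      exact ⟨by rwa [neg_inj, neg_eq_iff_eq_neg, or_comm] at h₁, h₂⟩

theorem three_pow_mod_eight (u : ℕ) : 3 ^ u % 8 = 1 ∨ 3 ^ u % 8 = 3 := by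
  induction u with
  | zero => simp
  | succ u ih => omega

theorem index_eq_one_of_three_pow (j t : ℕ) (h : (lehmerPair j).1.natAbs = 3 ^ (t + 1)) :
    j = 1 := by
  have h3 : (3 : ℤ) ∣ (lehmerPair j).1 := by
    rw [← Int.dvd_natAbs, h]
    exact ⟨3 ^ t, by push_cast; ring⟩
  have hj := three_dvd_lehmerPair j h3
  obtain ⟨i, rfl⟩ : ∃ i, j = 3 * i + 1 := ⟨j / 3, by omega⟩
  suffices i = 0 by omega
  rw [lehmerPair_triple, Int.natAbs_mul, Int.natAbs_mul, pow_succ' 3] at h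
  have hmul := Nat.eq_of_mul_eq_mul_left (show 0 < 3 by norm_num) h
  set w := (lehmerPair i).1
  obtain ⟨r, -, hr⟩ := (Nat.dvd_prime_pow Nat.prime_three).mp (Dvd.intro _ hmul)
  obtain ⟨s, -, hs⟩ := (Nat.dvd_prime_pow Nat.prime_three).mp (Dvd.intro_left _ hmul)
  have hw : w ^ 2 = (3 ^ r) ^ 2 := by
    rw [← Int.natAbs_sq, hr]; push_cast; rfl
  by_contra hi
  obtain ⟨l, rfl⟩ := Nat.exists_eq_succ_of_ne_zero hi
  have h8 := three_pow_mod_eight s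
  have hs' : w ^ 2 - 4 * 16 ^ (l + 1) = 3 ^ s ∨ w ^ 2 - 4 * 16 ^ (l + 1) = -3 ^ s := by
    have := Int.natAbs_eq (w ^ 2 - 4 * 16 ^ (l + 1))
    rw [hs] at this
    exact_mod_cast this
  have hw8 : (3 ^ r) ^ 2 % 8 = 1 := by
    rcases three_pow_mod_eight r with h' | h' <;> rw [Nat.pow_mod, h']
  have h16 : 16 ^ l % 3 = 1 := by simp [Nat.pow_mod]
  have h3s : 3 ^ s % 3 = 0 ∨ 3 ^ s % 3 = 1 := by
    cases s with
    | zero => simp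
    | succ s => omega
  zify at h8 hw8 h16 h3s
  rw [hw, pow_succ (16 : ℤ)] at hs'
  rcases hs' with hs' | hs'
  · rcases Nat.eq_zero_or_pos r with rfl | hr0
    · have : (0 : ℤ) < 16 ^ l := by positivity
      have : (0 : ℤ) < 3 ^ s := by positivity
      omega
    · obtain ⟨r', rfl⟩ : ∃ r', r = r' + 1 := ⟨r - 1, by omega⟩
      have hw3 : ((3 : ℤ) ^ (r' + 1)) ^ 2 % 3 = 0 := by
        rw [pow_succ (3 : ℤ), mul_pow]
        omega
      omega
  · omega

theorem exponent_conditions (x m n : ℕ) (hn : 0 < n)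
    (h : 13 * x ^ 2 + 3 ^ m = 2 ^ (n + 2)) :
    x % 2 = 1 ∧ ∃ t j, m = 2 * t + 1 ∧ n + 2 = 4 * j + 4 := by
  have h2 : 2 ^ (n + 2) % 8 = 0 := by
    obtain ⟨n', rfl⟩ := Nat.exists_eq_add_of_le' hn
    rw [pow_add, pow_add]
    omega
  have hx : x % 2 = 1 := by
    by_contra hx
    obtain ⟨y, rfl⟩ : 2 ∣ x := by omega
    rw [mul_pow] at h
    have := three_pow_mod_eight m
    omega
  refine ⟨hx, ?_⟩
  have hx8 : x ^ 2 % 8 = 1 := by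
    have : x % 8 = 1 ∨ x % 8 = 3 ∨ x % 8 = 5 ∨ x % 8 = 7 := by omega
    rcases this with h' | h' | h' | h' <;> rw [Nat.pow_mod, h']
  have hpow : ∀ u : ℕ, 9 ^ u % 8 = 1 := fun u => by simp [Nat.pow_mod]
  obtain ⟨t, ht⟩ : ∃ t, m = 2 * t + 1 := by
    obtain ⟨t, ht | ht⟩ := Nat.even_or_odd' m
    · exfalso
      rw [ht, pow_mul] at h
      have : (3 ^ 2) ^ t % 8 = 1 := by simp [Nat.pow_mod]
      omega
    · exact ⟨t, ht⟩
  obtain ⟨k, hk⟩ : ∃ k, n + 2 = 2 * k := by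
    obtain ⟨k, hk | hk⟩ := Nat.even_or_odd' (n + 2)
    · exact ⟨k, hk⟩
    · exfalso
      rw [hk, pow_succ 2, pow_mul, ht, pow_succ 3] at h
      have h4 : (2 ^ 2) ^ k % 3 = 1 := by simp [Nat.pow_mod]
      have hx3 : x ^ 2 % 3 = 0 ∨ x ^ 2 % 3 = 1 := by
        have : x % 3 = 0 ∨ x % 3 = 1 ∨ x % 3 = 2 := by omega
        rcases this with h' | h' | h' <;> simp [Nat.pow_mod, h']
      omega
  obtain ⟨j, hj⟩ : ∃ j, k = 2 * j := by
    obtain ⟨j, hj | hj⟩ := Nat.even_or_odd' k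
    · exact ⟨j, hj⟩
    · exfalso
      have h13 : ∀ u : ℕ, 3 ^ u % 13 = 1 ∨ 3 ^ u % 13 = 3 ∨ 3 ^ u % 13 = 9 := by
        intro u
        induction u with
        | zero => simp
        | succ u ih => omega
      have h16 : ∀ u : ℕ, 16 ^ u % 13 = 1 ∨ 16 ^ u % 13 = 3 ∨ 16 ^ u % 13 = 9 := by
        intro u
        induction u with
        | zero => simp
        | succ u ih => omega
      rw [hk, hj, show 2 * (2 * j + 1) = 4 * j + 2 by ring, pow_add 2, pow_mul] at h
      have := h13 m
      have : (2 ^ 4) ^ j % 13 = 1 ∨ (2 ^ 4) ^ j % 13 = 3 ∨ (2 ^ 4) ^ j % 13 = 9 := h16 j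
      omega
  exact ⟨t, j - 1, by omega, by omega⟩

theorem stmt_17 :
    {p : ℕ × ℕ × ℕ | 0 < p.1 ∧ 0 < p.2.1 ∧ 0 < p.2.2 ∧
        13 * p.1 ^ 2 + 3 ^ p.2.1 = 2 ^ (p.2.2 + 2)} =
      {(1, 1, 2), (1, 5, 6), (71, 1, 14)} := by
  ext ⟨x, m, n⟩
  simp only [Set.mem_ofPred_eq, Set.mem_insert_iff, Set.mem_singleton_iff, Prod.mk.injEq]
  constructor
  · rintro ⟨-, -, hn, h⟩
    obtain ⟨hx, t, j, rfl, hj⟩ := exponent_conditions x m n hn h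
    rw [hj] at h
    cases t with
    | zero =>
      have := thirteen_sq_add_three x j h
      omega
    | succ t =>
      obtain ⟨ha, hb⟩ := eq_lehmerPair j (3 ^ (t + 1)) x
        (by
          have := three_pow_mod_eight (t + 1)
          zify at this
          omega)
        (by omega) (by
          zify at h
          rw [show 4 * j + 4 = 4 * (j + 1) by ring, pow_mul 2] at h
          linear_combination h)
      obtain rfl := index_eq_one_of_three_pow j t (by
        zify
        rw [← abs_of_pos (show (0 : ℤ) < 3 ^ (t + 1) by positivity)]
        rcases ha with ha | ha <;> simp [ha])
      simp only [lehmerPair] at ha hb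
      have ht : 3 ^ (t + 1) = 3 ^ 2 := by
        zify
        have : (0 : ℤ) < 3 ^ (t + 1) := by positivity
        omega
      have := Nat.pow_right_injective (show 2 ≤ 3 by norm_num) ht
      omega
  · rintro (⟨rfl, rfl, rfl⟩ | ⟨rfl, rfl, rfl⟩ | ⟨rfl, rfl, rfl⟩)
    all_goals norm_num
end

section
/- The equation 31·x² + 97^m = 2^(n+2) has exactly three solutions in positive integers (x,m,n), namely (1,1,5), (65,1,15) and (15,2,12). -/
/-- The sequence with initial terms `a`, `b` satisfying `u (n + 2) = P * u (n + 1) - Q * u n`. -/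
def lucas (P Q : ℤ) : ℤ → ℤ → ℕ → ℤ
  | a, _, 0 => a
  | a, b, n + 1 => lucas P Q b (P * b - Q * a) n

section lucas

variable (P Q a b : ℤ)

@[simp] lemma lucas_zero : lucas P Q a b 0 = a := rfl

lemma lucas_succ (n : ℕ) : lucas P Q a b (n + 1) = lucas P Q b (P * b - Q * a) n := rfl

lemma lucas_add_two (n : ℕ) :
    lucas P Q a b (n + 2) = P * lucas P Q a b (n + 1) - Q * lucas P Q a b n := by
  induction n generalizing a b with
  | zero => rfl
  | succ n ih => exact ih b (P * b - Q * a)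

variable {P Q a b}

lemma lucas_add_modEq {m c : ℤ} {M : ℕ} (h₀ : lucas P Q a b M ≡ c * a [ZMOD m])
    (h₁ : lucas P Q a b (M + 1) ≡ c * b [ZMOD m]) (n : ℕ) :
    lucas P Q a b (n + M) ≡ c * lucas P Q a b n [ZMOD m] := by
  induction n using Nat.twoStepInduction with
  | zero => simpa using h₀
  | one => simpa [add_comm, lucas_succ] using h₁
  | more n ih₀ ih₁ =>
    rw [show n + 2 + M = n + M + 2 by ring, lucas_add_two, lucas_add_two,
      show c * (P * lucas P Q a b (n + 1) - Q * lucas P Q a b n) =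
        P * (c * lucas P Q a b (n + 1)) - Q * (c * lucas P Q a b n) by ring]
    rw [show n + 1 + M = n + M + 1 by ring] at ih₁
    exact (ih₁.mul_left P).sub (ih₀.mul_left Q)

lemma lucas_add_mul_modEq {m c : ℤ} {M : ℕ} (h₀ : lucas P Q a b M ≡ c * a [ZMOD m])
    (h₁ : lucas P Q a b (M + 1) ≡ c * b [ZMOD m]) (r t : ℕ) :
    lucas P Q a b (r + M * t) ≡ c ^ t * lucas P Q a b r [ZMOD m] := by
  induction t with
  | zero => simp
  | succ t ih =>
    rw [mul_add_one, ← add_assoc, pow_succ', mul_assoc]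
    exact (lucas_add_modEq h₀ h₁ _).trans (ih.mul_left c)

end lucas

/-- If `L` takes the same value at `1` and at a power of `1 + p * δ`, where `p` is an odd prime
not dividing `L δ`, then that power is the zeroth one. -/
lemma eq_zero_of_map_one_add_mul_pow_eq {R : Type*} [CommRing R] {p : ℕ} (hp : p.Prime)
    (hp3 : 3 ≤ p) (δ : R) (L : R →+ ℤ) (hδ : ¬ (p : ℤ) ∣ L δ) {s : ℕ}
    (hs : L ((1 + p * δ) ^ s) = L 1) : s = 0 := by
  by_contra hs0
  obtain ⟨j, r, hr, rfl⟩ := Nat.exists_eq_pow_mul_and_not_dvd hs0 p hp.ne_one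
  have hdvd : (p : R) * p * p ∣ (p : R) ^ p := by
    rw [show (p : R) * p * p = (p : R) ^ 3 by ring]
    exact pow_dvd_pow _ hp3
  obtain ⟨ε, hε⟩ := ZMod.exists_one_add_mul_pow_prime_pow_eq hp (dvd_refl (p : R)) hdvd δ j
  obtain ⟨κ, hκ⟩ := sq_dvd_add_pow_sub_sub ((p : R) ^ j * p * (δ + p * ε)) 1 r
  have key : (1 + (p : R) * δ) ^ (p ^ j * r) =
      1 + (p ^ (j + 1)) • (r • δ + p • (r • ε + p ^ j • ((δ + p * ε) ^ 2 * κ))) := by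
    rw [pow_mul, hε]
    simp only [nsmul_eq_mul]
    push_cast
    linear_combination hκ
  rw [key, map_add, map_nsmul, map_add, map_nsmul, map_nsmul, add_eq_left, smul_eq_zero] at hs
  have h := hs.resolve_left (pow_ne_zero _ hp.ne_zero)
  simp only [nsmul_eq_mul] at h
  have h' : (p : ℤ) ∣ r * L δ := ⟨-_, by rw [mul_neg]; exact eq_neg_of_add_eq_zero_left h⟩
  rcases (Nat.prime_iff_prime_int.mp hp).dvd_or_dvd h' with h' | h'
  · exact hr (Int.natCast_dvd_natCast.mp h')
  · exact hδ h'

open QuadraticAlgebra in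
lemma omega_pow_eq_lucas (P Q : ℤ) (n : ℕ) :
    (omega : QuadraticAlgebra ℤ (-Q) P) ^ n = ⟨lucas P Q 1 0 n, lucas P Q 0 1 n⟩ := by
  induction n using Nat.twoStepInduction with
  | zero => rfl
  | one => simp [lucas_succ]; rfl
  | more n ih₀ ih₁ =>
    rw [pow_add, pow_two, omega_mul_omega_eq_mk, ih₀]
    rw [pow_succ, ih₀] at ih₁
    have h₁ := congrArg re ih₁
    have h₂ := congrArg im ih₁
    simp at h₁ h₂
    ext <;> simp [lucas_add_two, ← h₁, ← h₂] <;> ring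

lemma lucas_eq_add (P Q a b : ℤ) (n : ℕ) :
    lucas P Q a b n = a * lucas P Q 1 0 n + b * lucas P Q 0 1 n := by
  induction n using Nat.twoStepInduction with
  | zero => simp
  | one => simp [lucas_succ]
  | more n ih₀ ih₁ => simp only [lucas_add_two, ih₀, ih₁]; ring

/-- A Lucas sequence with period `M` modulo an odd prime `p`, and not modulo `p ^ 2`, takes its
initial value only once on the multiples of `M`. -/
lemma eq_zero_of_lucas_mul_eq {P Q a b : ℤ} {M t p : ℕ} (hp : p.Prime) (hp3 : 3 ≤ p)
    (h₀ : (p : ℤ) ∣ lucas P Q 1 0 M - 1) (h₁ : (p : ℤ) ∣ lucas P Q 0 1 M)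
    (h₂ : ¬ (p : ℤ) ^ 2 ∣ lucas P Q a b M - a) (h : lucas P Q a b (M * t) = a) : t = 0 := by
  obtain ⟨c, hc⟩ := h₀
  obtain ⟨d, hd⟩ := h₁
  let δ : QuadraticAlgebra ℤ (-Q) P := ⟨c, d⟩
  let L : QuadraticAlgebra ℤ (-Q) P →+ ℤ :=
    AddMonoidHom.mk' (fun z ↦ a * z.re + b * z.im) fun x y ↦ by simp; ring
  have hL (n : ℕ) : L (QuadraticAlgebra.omega ^ n) = lucas P Q a b n := by
    rw [omega_pow_eq_lucas, lucas_eq_add P Q a b]; rfl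
  have hω : (QuadraticAlgebra.omega : QuadraticAlgebra ℤ (-Q) P) ^ M = 1 + p * δ := by
    rw [omega_pow_eq_lucas, hd, eq_add_of_sub_eq hc]
    ext <;> simp [δ, QuadraticAlgebra.re_one, QuadraticAlgebra.im_one, add_comm]
  refine eq_zero_of_map_one_add_mul_pow_eq hp hp3 δ L ?_ (s := t) ?_
  · rintro ⟨e, he⟩
    refine h₂ ⟨e, ?_⟩
    rw [lucas_eq_add, hd, eq_add_of_sub_eq hc]
    change a * c + b * d = _ at he
    linear_combination p * he
  · rw [← hω, ← pow_mul, hL, h]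
    simp [L, QuadraticAlgebra.re_one, QuadraticAlgebra.im_one]

lemma lucas_modEq_of_double_root {P Q b r m : ℤ} (hP : P ≡ 2 * r [ZMOD m])
    (hQ : Q ≡ r ^ 2 [ZMOD m]) (hb : b ≡ 3 * r [ZMOD m]) (s : ℕ) :
    lucas P Q 1 b s ≡ r ^ s * (2 * s + 1) [ZMOD m] := by
  induction s using Nat.twoStepInduction with
  | zero => simp [Int.ModEq.refl]
  | one =>
    simp only [lucas_succ, lucas_zero]
    exact hb.trans (by push_cast; ring_nf; rfl)
  | more n ih₀ ih₁ =>
    rw [lucas_add_two]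
    refine ((hP.mul ih₁).sub (hQ.mul ih₀)).trans ?_
    push_cast
    ring_nf
    rfl

lemma exponent_eq_zero_of_lucas_natAbs_eq {P Q b r q : ℤ} (hP : P ≡ 2 * r [ZMOD 97])
    (hQ : Q ≡ r ^ 2 [ZMOD 97]) (hb : b ≡ 3 * r [ZMOD 97]) (hr : ¬ (97 : ℤ) ∣ r)
    (hq : ¬ IsUnit q) (hq97 : IsCoprime q 97) (hq48 : q ∣ lucas P Q 1 b 48)
    (hq98 : lucas P Q 1 b 98 ≡ lucas P Q 1 b 97 * b [ZMOD q])
    {s j : ℕ} (h : (lucas P Q 1 b s).natAbs = 97 ^ j) : j = 0 := by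
  by_contra hj
  have hs : lucas P Q 1 b s ∣ 97 ^ j := by
    rw [← Int.natAbs_dvd_natAbs, h, Int.natAbs_pow]; rfl
  have h97 : (97 : ℤ) ∣ lucas P Q 1 b s := by
    rw [← Int.natAbs_dvd_natAbs, h]
    exact dvd_pow_self 97 hj
  have hp : Prime (97 : ℤ) := Nat.prime_iff_prime_int.mp (by norm_num : Nat.Prime 97)
  rw [(lucas_modEq_of_double_root hP hQ hb s).dvd_iff] at h97
  have h2s := (hp.dvd_or_dvd h97).resolve_left fun h ↦ hr (hp.dvd_of_dvd_pow h)
  obtain ⟨t, rfl⟩ : ∃ t, s = 48 + 97 * t := ⟨s / 97, by omega⟩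
  have hqs : q ∣ lucas P Q 1 b (48 + 97 * t) :=
    ((lucas_add_mul_modEq (by rw [mul_one]) hq98 48 t).dvd_iff).mpr
      (hq48.mul_left _)
  exact hq ((hq97.pow_right (n := j)).isUnit_of_dvd' (dvd_refl q) (hqs.trans hs))

lemma exponent_eq_zero_of_lucas_neg_thirtyThree {s j : ℕ}
    (h : (lucas (-33) 1024 1 (-1) s).natAbs = 97 ^ j) : j = 0 :=
  exponent_eq_zero_of_lucas_natAbs_eq (r := 32) (q := 4657) (by decide) (by decide) (by decide)
    (by decide) (by decide) (by norm_num) (by decide +kernel) (by decide +kernel) h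

lemma exponent_eq_zero_of_lucas_1217 {s j : ℕ}
    (h : (lucas 1217 (8 ^ 8) 1 (-2879) s).natAbs = 97 ^ j) : j = 0 :=
  exponent_eq_zero_of_lucas_natAbs_eq (r := 75) (q := lucas 1217 (8 ^ 8) 1 (-2879) 48 / 97)
    (by decide) (by decide) (by decide) (by decide) (by rw [Int.isUnit_iff]; decide +kernel)
    (by rw [Int.isCoprime_iff_gcd_eq_one]; decide +kernel)
    (by decide +kernel) (by decide +kernel) h

lemma eq_of_lucas_neg_thirtyThree_natAbs_eq_one {s : ℕ}
    (h : (lucas (-33) 1024 1 (-1) s).natAbs = 1) : s = 0 ∨ s = 1 := by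
  have hmod := lucas_add_mul_modEq (P := -33) (Q := 1024) (a := 1) (b := -1) (m := 23) (c := 1)
    (M := 11) (by decide +kernel) (by decide +kernel) (s % 11) (s / 11)
  have hs := Nat.mod_add_div s 11
  rw [hs, one_pow, one_mul] at hmod
  have hlt := Nat.mod_lt s (by norm_num : 11 > 0)
  have h₀ : (23 : ℤ) ∣ lucas (-33) 1024 1 0 11 - 1 := by decide +kernel
  have h₁ : (23 : ℤ) ∣ lucas (-33) 1024 0 1 11 := by decide +kernel
  rcases Int.natAbs_eq_iff.mp h with h | h <;> rw [h] at hmod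
  · have hr : ∀ r < 11, 1 ≡ lucas (-33) 1024 1 (-1) r [ZMOD 23] → r = 0 := by decide +kernel
    rw [hr _ hlt hmod, zero_add] at hs
    rw [← hs] at h ⊢
    have := eq_zero_of_lucas_mul_eq (by norm_num : Nat.Prime 23) (by norm_num) h₀ h₁
      (by decide +kernel) h
    omega
  · have hr : ∀ r < 11, -1 ≡ lucas (-33) 1024 1 (-1) r [ZMOD 23] → r = 1 := by decide +kernel
    rw [hr _ hlt hmod, add_comm] at hs
    rw [← hs, lucas_succ] at h
    have := eq_zero_of_lucas_mul_eq (by norm_num : Nat.Prime 23) (by norm_num) h₀ h₁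
      (by decide +kernel) h
    omega

lemma eq_zero_of_lucas_1217_natAbs_eq_one {s : ℕ}
    (h : (lucas 1217 (8 ^ 8) 1 (-2879) s).natAbs = 1) : s = 0 := by
  have hmod := lucas_add_mul_modEq (P := 1217) (Q := 8 ^ 8) (a := 1) (b := -2879) (m := 47)
    (c := 1) (M := 23) (by decide +kernel) (by decide +kernel) (s % 23) (s / 23)
  have hs := Nat.mod_add_div s 23
  rw [hs, one_pow, one_mul] at hmod
  have hlt := Nat.mod_lt s (by norm_num : 23 > 0)
  rcases Int.natAbs_eq_iff.mp h with h | h <;> rw [h] at hmod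
  · have hr : ∀ r < 23, 1 ≡ lucas 1217 (8 ^ 8) 1 (-2879) r [ZMOD 47] → r = 0 := by
      decide +kernel
    rw [hr _ hlt hmod, zero_add] at hs
    rw [← hs] at h ⊢
    rw [eq_zero_of_lucas_mul_eq (p := 47) (by norm_num) (by norm_num) (by decide +kernel)
      (by decide +kernel) (by decide +kernel) h]
  · have hr : ∀ r < 23, ¬ -1 ≡ lucas 1217 (8 ^ 8) 1 (-2879) r [ZMOD 47] := by decide +kernel
    exact absurd hmod (hr _ hlt)

lemma lucas_one_eight_add_eight_mul (u : ℕ) :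
    lucas 1 8 1 (-15) (3 + 8 * u) = 97 * lucas 1217 (8 ^ 8) 1 (-2879) u := by
  have hstep (n : ℕ) : lucas 1 8 1 (-15) (n + 16) =
      1217 * lucas 1 8 1 (-15) (n + 8) - 8 ^ 8 * lucas 1 8 1 (-15) n := by
    simp only [lucas_add_two]
    ring
  induction u using Nat.twoStepInduction with
  | zero => decide
  | one => decide
  | more u ih₀ ih₁ =>
    rw [lucas_add_two, show 3 + 8 * (u + 2) = 3 + 8 * u + 16 by ring, hstep,
      show 3 + 8 * u + 8 = 3 + 8 * (u + 1) by ring, ih₀, ih₁]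
    ring

lemma eq_of_lucas_one_eight_natAbs_eq {k j : ℕ}
    (h : (lucas 1 8 1 (-15) k).natAbs = 97 ^ (j + 1)) : k = 3 ∧ j = 0 := by
  have h97 : (97 : ℤ) ∣ lucas 1 8 1 (-15) k := by
    rw [← Int.natAbs_dvd_natAbs, h]
    exact dvd_pow_self 97 (by omega)
  obtain ⟨u, rfl⟩ : ∃ u, k = 3 + 8 * u := by
    have hmod := lucas_add_mul_modEq (P := 1) (Q := 8) (a := 1) (b := -15) (m := 97) (c := 75)
      (M := 8) (by decide +kernel) (by decide +kernel) (k % 8) (k / 8)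
    rw [Nat.mod_add_div k 8] at hmod
    rw [hmod.dvd_iff] at h97
    have hp : Prime (97 : ℤ) := Nat.prime_iff_prime_int.mp (by norm_num : Nat.Prime 97)
    have hr : ∀ r < 8, (97 : ℤ) ∣ lucas 1 8 1 (-15) r → r = 3 := by decide +kernel
    have := hr _ (Nat.mod_lt _ (by norm_num))
      ((hp.dvd_or_dvd h97).resolve_left fun h ↦ absurd (hp.dvd_of_dvd_pow h) (by decide))
    exact ⟨k / 8, by omega⟩
  rw [lucas_one_eight_add_eight_mul, Int.natAbs_mul, pow_succ' (97 : ℕ)] at h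
  have hj := Nat.eq_of_mul_eq_mul_left (by norm_num : 0 < 97) h
  obtain rfl := exponent_eq_zero_of_lucas_1217 hj
  rw [eq_zero_of_lucas_1217_natAbs_eq_one hj]
  simp

lemma two_pow_dvd_of_dvd_mul_odd {a b : ℤ} (hb : Odd b) (k : ℕ) (h : 2 ^ k ∣ a * b) :
    2 ^ k ∣ a :=
  (Int.isCoprime_two_left.mpr hb).pow_left.dvd_of_dvd_mul_right h

lemma one_le_sq_of_odd {x : ℤ} (hx : Odd x) : 1 ≤ x ^ 2 :=
  (sq_nonneg x).lt_of_ne' (pow_ne_zero _ (by rintro rfl; simp at hx))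

lemma exists_lucas_eq_of_sq_add_mul_sq_eq_two_pow (n : ℕ) (x y : ℤ) (hx : Odd x) (hy : Odd y)
    (hxy : x ≡ y [ZMOD 4]) (h : y ^ 2 + 31 * x ^ 2 = 2 ^ (n + 2)) :
    ∃ k, n = 3 * (k + 1) ∧ ∃ ε : ℤ, (ε = 1 ∨ ε = -1) ∧ y = ε * lucas 1 8 1 (-15) k ∧
      y - 31 * x = 2 * (ε * lucas 1 8 1 (-15) (k + 1)) := by
  induction n using Nat.strong_induction_on generalizing x y with
  | _ n ih =>
  have hx1 := one_le_sq_of_odd hx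
  have hy1 := one_le_sq_of_odd hy
  obtain hn | rfl | ⟨n, rfl⟩ : n < 3 ∨ n = 3 ∨ ∃ m, n = m + 4 := by
    rcases lt_trichotomy n 3 with h | h | h
    · exact Or.inl h
    · exact Or.inr (Or.inl h)
    · exact Or.inr (Or.inr ⟨n - 4, by omega⟩)
  · interval_cases n <;> norm_num at h <;> omega
  · have hx2 : x = 1 ∨ x = -1 := sq_eq_one_iff.mp (by omega)
    have hy2 : y = 1 ∨ y = -1 := sq_eq_one_iff.mp (by omega)
    refine ⟨0, rfl, y, hy2, by simp, ?_⟩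
    rcases hx2 with rfl | rfl <;> rcases hy2 with rfl | rfl <;> revert hxy <;> decide
  · obtain ⟨a, ha⟩ := hxy.symm.dvd
    obtain rfl : x = y + 4 * a := by linarith
    have ha4 : 31 * a * (y + 2 * a) = 2 ^ 2 * (2 * 2 ^ n - y ^ 2) := by
      rw [show n + 4 + 2 = n + 6 by ring, pow_add] at h
      linarith
    obtain ⟨X, rfl⟩ : (2 : ℤ) ^ 2 ∣ a := by
      refine two_pow_dvd_of_dvd_mul_odd (b := 31 * (y + 2 * a)) ?_ 2 ⟨2 * 2 ^ n - y ^ 2, ?_⟩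
      · exact Odd.mul (by decide) (hy.add_even (even_two_mul a))
      · linarith
    have hX : X * (31 * (y + 8 * X)) = 2 * 2 ^ n - y ^ 2 := by linarith
    have hXo : Odd X := by
      have : Odd (X * (31 * (y + 8 * X))) := by
        rw [hX]
        exact (even_two_mul _).sub_odd hy.pow
      exact (Int.odd_mul.mp this).1
    obtain ⟨k, hk, ε, hε, h₁, h₂⟩ := ih (n + 1) (by omega) X (2 * y + 31 * X) hXo
      ((even_two_mul y).add_odd (Odd.mul (by decide) hXo))
      (Int.modEq_iff_dvd.mpr (by obtain ⟨c, rfl⟩ := hy; obtain ⟨d, rfl⟩ := hXo; omega))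
      (by rw [show n + 1 + 2 = n + 3 by ring, pow_add]; linarith)
    refine ⟨k + 1, by omega, ε, hε, by linarith, ?_⟩
    rw [lucas_add_two]
    linarith

lemma exists_lucas_eq_of_mul_sq_add_mul_sq_eq_two_pow (n : ℕ) (x y : ℤ) (hx : Odd x)
    (hy : Odd y) (hxy : x ≡ y [ZMOD 4]) (h : 31 * x ^ 2 + 97 * y ^ 2 = 2 ^ (n + 2)) :
    ∃ s, n = 5 + 10 * s ∧ ∃ ε : ℤ, (ε = 1 ∨ ε = -1) ∧ y = ε * lucas (-33) 1024 1 (-1) s ∧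
      31 * x - 33 * y = 2 * (ε * lucas (-33) 1024 1 (-1) (s + 1)) := by
  induction n using Nat.strong_induction_on generalizing x y with
  | _ n ih =>
  have hx1 := one_le_sq_of_odd hx
  have hy1 := one_le_sq_of_odd hy
  obtain hn | rfl | ⟨n, rfl⟩ : n < 5 ∨ n = 5 ∨ ∃ m, n = m + 6 := by
    rcases lt_trichotomy n 5 with h | h | h
    · exact Or.inl h
    · exact Or.inr (Or.inl h)
    · exact Or.inr (Or.inr ⟨n - 6, by omega⟩)
  · interval_cases n <;> norm_num at h <;> omega
  · have hx2 : x = 1 ∨ x = -1 := sq_eq_one_iff.mp (by omega)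
    have hy2 : y = 1 ∨ y = -1 := sq_eq_one_iff.mp (by omega)
    refine ⟨0, rfl, y, hy2, by simp, ?_⟩
    rcases hx2 with rfl | rfl <;> rcases hy2 with rfl | rfl <;> revert hxy <;> decide
  · obtain ⟨a, ha⟩ := hxy.dvd
    obtain rfl : x = y - 4 * a := by linarith
    have ha16 : 31 * a * (y - 2 * a) = 2 ^ 4 * (y ^ 2 - 2 * 2 ^ n) := by
      rw [show n + 6 + 2 = n + 8 by ring, pow_add] at h
      linarith
    obtain ⟨Y, rfl⟩ : (2 : ℤ) ^ 4 ∣ a := by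
      refine two_pow_dvd_of_dvd_mul_odd (b := 31 * (y - 2 * a)) ?_ 4 ⟨y ^ 2 - 2 * 2 ^ n, ?_⟩
      · exact Odd.mul (by decide) (hy.sub_even (even_two_mul a))
      · linarith
    have hY : Y * (31 * (y - 32 * Y)) = y ^ 2 - 2 * 2 ^ n := by linarith
    have hYo : Odd Y := by
      have : Odd (Y * (31 * (y - 32 * Y))) := by
        rw [hY]
        exact hy.pow.sub_even (even_two_mul _)
      exact (Int.odd_mul.mp this).1
    have hXY : (2 * y - 31 * Y) ^ 2 + 3007 * Y ^ 2 = 8 * 2 ^ n := by linarith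
    obtain ⟨k, rfl⟩ : ∃ k, n = k + 9 := by
      refine ⟨n - 9, ?_⟩
      by_contra hn
      have hn8 : (2 : ℤ) ^ n ≤ 2 ^ 8 := pow_le_pow_right₀ (by norm_num) (by omega)
      nlinarith [one_le_sq_of_odd hYo, sq_nonneg (2 * y - 31 * Y)]
    obtain ⟨b, rfl⟩ : ∃ b, y = 2 * b - 33 * Y := by
      obtain ⟨c, rfl⟩ := hy
      obtain ⟨d, rfl⟩ := hYo
      exact ⟨c + 33 * d + 17, by ring⟩
    rw [pow_add] at hXY
    have hb16 : b * (2 * b - 97 * Y) = 2 ^ 4 * (32 * 2 ^ k - 97 * Y ^ 2) := by linarith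
    obtain ⟨x, rfl⟩ : (2 : ℤ) ^ 4 ∣ b :=
      two_pow_dvd_of_dvd_mul_odd ((even_two_mul b).sub_odd (Odd.mul (by decide) hYo)) 4
        ⟨_, hb16⟩
    have hx : x * (32 * x - 97 * Y) = 32 * 2 ^ k - 97 * Y ^ 2 := by linarith
    have hxo : Odd x := by
      have : Odd (x * (32 * x - 97 * Y)) := by
        rw [hx]
        exact (Even.mul_right (by decide) _).sub_odd (Odd.mul (by decide) hYo.pow)
      exact (Int.odd_mul.mp this).1
    obtain ⟨s, hs, ε, hε, h₁, h₂⟩ := ih (k + 5) (by omega) x (2 * Y - x) hxo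
      ((even_two_mul Y).sub_odd hxo)
      (Int.modEq_iff_dvd.mpr (by obtain ⟨c, rfl⟩ := hxo; obtain ⟨d, rfl⟩ := hYo; omega))
      (by rw [show k + 5 + 2 = k + 7 by ring, pow_add]; linarith)
    refine ⟨s + 1, by omega, ε, hε, by linarith, ?_⟩
    rw [lucas_add_two]
    linarith

lemma natAbs_mul_of_eq_one_or_neg_one {ε z : ℤ} (hε : ε = 1 ∨ ε = -1) :
    (ε * z).natAbs = z.natAbs := by
  rcases hε with rfl | rfl <;> simp

lemma odd_of_mul_sq_add_pow_eq_two_pow {x m n : ℕ} (h : 31 * x ^ 2 + 97 ^ m = 2 ^ (n + 2)) :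
    Odd x := by
  by_contra hx
  have h₁ : Even (31 * x ^ 2 + 97 ^ m) := by
    rw [h, pow_succ]
    exact even_two.mul_left _
  have h₂ : Odd (97 ^ m) := Odd.pow (by decide)
  exact Nat.not_even_iff_odd.mpr
    ((((Nat.not_odd_iff_even.mp hx).pow_of_ne_zero two_ne_zero).mul_left 31).add_odd h₂) h₁

/-- One of two odd numbers that differ by a sign is congruent to a given odd number modulo `4`. -/
lemma exists_sq_eq_and_modEq_four {x y : ℤ} (hx : Odd x) (hy : Odd y) :
    ∃ z : ℤ, z ^ 2 = x ^ 2 ∧ Odd z ∧ z ≡ y [ZMOD 4] := by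
  by_cases h : x ≡ y [ZMOD 4]
  · exact ⟨x, rfl, hx, h⟩
  · refine ⟨-x, by ring, hx.neg, ?_⟩
    rw [Int.ModEq] at h ⊢
    obtain ⟨c, rfl⟩ := hx
    obtain ⟨d, rfl⟩ := hy
    omega

/-- The equation `31·x² + 97^m = 2^(n+2)` has exactly the three positive
solutions `(1,1,5)`, `(65,1,15)` and `(15,2,12)`. -/
theorem stmt_18 :
    {p : ℕ × ℕ × ℕ | 0 < p.1 ∧ 0 < p.2.1 ∧ 0 < p.2.2 ∧
        31 * p.1 ^ 2 + 97 ^ p.2.1 = 2 ^ (p.2.2 + 2)} =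
      {(1, 1, 5), (65, 1, 15), (15, 2, 12)} := by
  ext ⟨x, m, n⟩
  simp only [Set.mem_ofPred_eq, Set.mem_insert_iff, Set.mem_singleton_iff, Prod.mk.injEq]
  constructor
  · rintro ⟨-, hm, -, h⟩
    have hx := (Int.odd_coe_nat x).mpr (odd_of_mul_sq_add_pow_eq_two_pow h)
    have hpow (j : ℕ) : Odd ((97 : ℤ) ^ j) := Odd.pow (by decide)
    have hz : 31 * (x : ℤ) ^ 2 + 97 ^ m = 2 ^ (n + 2) := by exact_mod_cast h
    rcases Nat.even_or_odd' m with ⟨j, rfl | rfl⟩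
    · obtain ⟨i, rfl⟩ : ∃ i, j = i + 1 := ⟨j - 1, by omega⟩
      obtain ⟨z, hzx, hzo, hz4⟩ := exists_sq_eq_and_modEq_four hx (hpow (i + 1))
      obtain ⟨k, rfl, ε, hε, hy, -⟩ := exists_lucas_eq_of_sq_add_mul_sq_eq_two_pow n z _ hzo
        (hpow (i + 1)) hz4 (by rw [hzx, ← hz, ← pow_mul]; ring)
      obtain ⟨rfl, rfl⟩ := eq_of_lucas_one_eight_natAbs_eq (k := k) (j := i) (by
        rw [← natAbs_mul_of_eq_one_or_neg_one hε, ← hy, Int.natAbs_pow]; rfl)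
      have hx15 : x ^ 2 = 15 ^ 2 := by norm_num at h; omega
      exact Or.inr (Or.inr ⟨Nat.pow_left_injective two_ne_zero hx15, rfl, rfl⟩)
    · obtain ⟨z, hzx, hzo, hz4⟩ := exists_sq_eq_and_modEq_four hx (hpow j)
      obtain ⟨s, rfl, ε, hε, hy, -⟩ := exists_lucas_eq_of_mul_sq_add_mul_sq_eq_two_pow n z _ hzo
        (hpow j) hz4 (by rw [hzx, ← hz, ← pow_mul]; ring)
      have hs : (lucas (-33) 1024 1 (-1) s).natAbs = 97 ^ j := by
        rw [← natAbs_mul_of_eq_one_or_neg_one hε, ← hy, Int.natAbs_pow]; rfl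
      obtain rfl := exponent_eq_zero_of_lucas_neg_thirtyThree hs
      rcases eq_of_lucas_neg_thirtyThree_natAbs_eq_one hs with rfl | rfl
      · have hx1 : x ^ 2 = 1 ^ 2 := by norm_num at h; omega
        exact Or.inl ⟨Nat.pow_left_injective two_ne_zero hx1, rfl, rfl⟩
      · have hx65 : x ^ 2 = 65 ^ 2 := by norm_num at h; omega
        exact Or.inr (Or.inl ⟨Nat.pow_left_injective two_ne_zero hx65, rfl, rfl⟩)
  · rintro (⟨rfl, rfl, rfl⟩ | ⟨rfl, rfl, rfl⟩ | ⟨rfl, rfl, rfl⟩) <;> norm_num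
end

section
/- The equation 7·x² + 3^m = 2^(n+2) has exactly two solutions in positive integers (x,m,n), namely (1,2,2) and (5,4,6); in particular, every solution has m even. -/
theorem three_pow_mod_eight_s19 (m : ℕ) :
    (Even m ∧ 3 ^ m % 8 = 1) ∨ (¬ Even m ∧ 3 ^ m % 8 = 3) := by
  induction m with
  | zero => simp
  | succ m ih =>
    rw [pow_succ, Nat.even_add_one]
    rcases ih with ⟨h, h'⟩ | ⟨h, h'⟩
    · right; exact ⟨not_not.mpr h, by omega⟩
    · left; exact ⟨h, by omega⟩

theorem even_of_two_pow_mod_three {s a : ℕ} (h : 2 ^ s % 3 = a ^ 2 % 3) : Even s := by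
  by_contra hs
  obtain ⟨t, rfl⟩ := Nat.not_even_iff_odd.mp hs
  have h2 : 2 ^ (2 * t + 1) % 3 = 2 := by
    rw [pow_succ, pow_mul, Nat.mul_mod, Nat.pow_mod]
    norm_num
  have h3 : a % 3 = 0 ∨ a % 3 = 1 ∨ a % 3 = 2 := by omega
  rw [h2, Nat.pow_mod] at h
  rcases h3 with h3 | h3 | h3 <;> simp [h3] at h

theorem even_of_seven_mul_sq_add_three_pow {x m n : ℕ} (hn : 0 < n)
    (h : 7 * x ^ 2 + 3 ^ m = 2 ^ (n + 2)) : Even m := by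
  obtain ⟨k, rfl⟩ := Nat.exists_eq_add_of_lt hn
  have h8 : 2 ^ (0 + k + 1 + 2) = 8 * 2 ^ k := by ring
  rcases three_pow_mod_eight_s19 m with ⟨hm, -⟩ | ⟨-, hm⟩
  · exact hm
  · have hx : x % 8 < 8 := Nat.mod_lt _ (by norm_num)
    have hsq : x ^ 2 % 8 = (x % 8) ^ 2 % 8 := Nat.pow_mod _ _ _
    interval_cases x % 8 <;> omega

theorem eq_one_of_mul_eq_three_pow {u v k : ℕ} (huv : u ≤ v) (h : u * v = 3 ^ k)
    (h3 : ¬ (3 ∣ u ∧ 3 ∣ v)) : u = 1 := by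
  obtain ⟨i, -, rfl⟩ := (Nat.dvd_prime_pow Nat.prime_three).mp (Dvd.intro _ h)
  obtain ⟨j, -, rfl⟩ := (Nat.dvd_prime_pow Nat.prime_three).mp (Dvd.intro_left _ h)
  rcases Nat.eq_zero_or_pos i with rfl | hi
  · simp
  rcases Nat.eq_zero_or_pos j with rfl | hj
  · have := Nat.one_le_pow i 3 (by norm_num)
    simp only [pow_zero] at huv
    omega
  · exact absurd ⟨dvd_pow_self 3 hi.ne', dvd_pow_self 3 hj.ne'⟩ h3

theorem not_three_dvd_two_pow (r : ℕ) : ¬ 3 ∣ 2 ^ r := fun h => by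
  have := Nat.prime_three.dvd_of_dvd_pow h
  omega

theorem three_pow_ne_two_pow_add_one {r k : ℕ} (hr : 4 ≤ r) : 3 ^ k ≠ 2 ^ r + 1 := by
  intro h
  obtain ⟨q, rfl⟩ := Nat.exists_eq_add_of_le hr
  have h16 : 2 ^ (4 + q) = 16 * 2 ^ q := by ring
  have hk : 3 ^ k = 81 ^ (k / 4) * 3 ^ (k % 4) := by
    rw [show 81 = 3 ^ 4 by norm_num, ← pow_mul, ← pow_add, Nat.div_add_mod]
  have h80 : 81 ^ (k / 4) % 80 = 1 := by rw [Nat.pow_mod]; simp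
  have hlt : k % 4 < 4 := Nat.mod_lt _ (by norm_num)
  have h5 : ¬ 5 ∣ 2 ^ (4 + q) := fun hd => by
    have := Nat.prime_five.dvd_of_dvd_pow hd
    omega
  interval_cases k % 4 <;> omega

theorem three_pow_add_one_eq_two_pow {r k : ℕ} (h : 3 ^ k + 1 = 2 ^ r) : r ≤ 2 := by
  by_contra! hr
  obtain ⟨q, rfl⟩ := Nat.exists_eq_add_of_lt hr
  have h8 : 2 ^ (2 + q + 1) = 8 * 2 ^ q := by ring
  rcases three_pow_mod_eight_s19 k with ⟨-, hk⟩ | ⟨-, hk⟩ <;> omega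

theorem two_pow_add_three_pow_eq_sq {s k b : ℕ} (hk : 0 < k) (hlt : 3 ^ k < 2 ^ s)
    (h : 2 ^ s + 3 ^ k = b ^ 2) : s = 4 ∧ k = 2 := by
  have h3k : 3 ∣ 3 ^ k := dvd_pow_self 3 hk.ne'
  obtain ⟨t, rfl⟩ := even_of_two_pow_mod_three (s := s) (a := b) (by omega)
  have hpos : 0 < 3 ^ k := by positivity
  have htb : 2 ^ t < b := by
    by_contra! hb
    have := Nat.pow_le_pow_left hb 2
    rw [← pow_mul, mul_two] at this
    omega
  obtain ⟨u, rfl⟩ := Nat.exists_eq_add_of_lt htb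
  have hmul : (u + 1) * (u + 1 + 2 ^ (t + 1)) = 3 ^ k := by
    apply Nat.add_left_cancel (n := 2 ^ (t + t))
    rw [h]
    ring
  have hu := eq_one_of_mul_eq_three_pow (Nat.le_add_right _ _) hmul fun ⟨h1, h2⟩ =>
    not_three_dvd_two_pow _ ((Nat.dvd_add_right h1).mp h2)
  rw [hu, one_mul] at hmul
  have ht : t + 1 < 4 := by
    by_contra! ht
    exact three_pow_ne_two_pow_add_one (k := k) ht (by omega)
  have ht' : t < 3 := by omega
  interval_cases t
  · norm_num at hlt
  · norm_num at hmul
    omega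
  · exact ⟨rfl, Nat.pow_right_injective (a := 3) (by norm_num) (by simpa using hmul.symm)⟩

theorem sq_add_three_pow_eq_two_pow {s k a : ℕ} (hk : 0 < k)
    (h : a ^ 2 + 3 ^ k = 2 ^ s) : s = 2 ∧ k = 1 := by
  have h3k : 3 ∣ 3 ^ k := dvd_pow_self 3 hk.ne'
  obtain ⟨t, rfl⟩ := even_of_two_pow_mod_three (s := s) (a := a) (by omega)
  have hpos : 0 < 3 ^ k := by positivity
  have hat : a < 2 ^ t := by
    by_contra! hb
    have := Nat.pow_le_pow_left hb 2
    rw [← pow_mul, mul_two] at this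
    omega
  obtain ⟨u, hu⟩ := Nat.exists_eq_add_of_lt hat
  have hmul : (u + 1) * (u + 1 + 2 * a) = 3 ^ k := by
    apply Nat.add_left_cancel (n := a ^ 2)
    rw [h, pow_add, hu]
    ring
  have hsum : (u + 1) + (u + 1 + 2 * a) = 2 ^ (t + 1) := by
    rw [pow_succ, hu]
    ring
  have hu1 := eq_one_of_mul_eq_three_pow (by omega) hmul fun ⟨h1, h2⟩ =>
    not_three_dvd_two_pow _ (hsum ▸ dvd_add h1 h2)
  rw [hu1, one_mul] at hmul
  have ht := three_pow_add_one_eq_two_pow (k := k) (r := t + 1) (by omega)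
  have h3le : 3 ≤ 3 ^ k := Nat.le_of_dvd hpos h3k
  have ht' : t < 2 := by omega
  interval_cases t
  · norm_num at hsum
    omega
  · refine ⟨rfl, Nat.pow_right_injective (a := 3) (by norm_num) ?_⟩
    norm_num at hsum ⊢
    omega

theorem exponents_of_seven_mul_sq_add_nine_pow {x k s : ℕ} (hx : 0 < x) (hk : 0 < k)
    (h : 7 * x ^ 2 + 3 ^ (k + k) = 2 ^ (s + s)) : s = 4 ∧ k = 2 ∨ s = 2 ∧ k = 1 := by
  have hx2 : 0 < x ^ 2 := by positivity
  have hlt : 3 ^ k < 2 ^ s := by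
    by_contra! hle
    have := Nat.mul_le_mul hle hle
    rw [← pow_add, ← pow_add] at this
    omega
  obtain ⟨d, hd⟩ := Nat.exists_eq_add_of_lt hlt
  obtain ⟨c, hc⟩ : ∃ c, c = d + 1 := ⟨_, rfl⟩
  have hcs : 2 ^ s = 3 ^ k + c := by omega
  have hmul : c * (2 ^ s + 3 ^ k) = 7 * x ^ 2 := by
    apply Nat.add_right_cancel (m := 3 ^ (k + k))
    rw [h, pow_add, pow_add, hcs]
    ring
  have hcop : Nat.Coprime c (2 ^ s + 3 ^ k) := by
    have hpow : Nat.Coprime (2 ^ s) (3 ^ k) := Nat.Coprime.pow _ _ (by norm_num)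
    have hc3 : Nat.Coprime c (3 ^ k) := by
      rw [hcs] at hpow
      simpa using hpow
    have hc2 : Nat.Coprime c 2 := by
      rw [Nat.coprime_two_right, Nat.odd_iff]
      have h3 : 3 ^ k % 2 = 1 := by rw [Nat.pow_mod]; norm_num
      have hs : s ≠ 0 := by
        rintro rfl
        exact hlt.not_ge (Nat.one_le_pow _ _ (by norm_num))
      have h2 : 2 ∣ 2 ^ s := dvd_pow_self 2 hs
      omega
    rw [show 2 ^ s + 3 ^ k = 2 * 3 ^ k + c by omega, Nat.coprime_add_self_right]
    exact hc2.mul_right hc3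
  rcases (Nat.Prime.dvd_mul (by norm_num : Nat.Prime 7)).mp (Dvd.intro _ hmul.symm) with
    ⟨e, he⟩ | ⟨e, he⟩
  · rw [he, mul_assoc] at hmul
    have hsq := Nat.eq_of_mul_eq_mul_left (by norm_num) hmul
    rw [mul_comm] at hsq
    rw [he] at hcop
    obtain ⟨b, hb⟩ := exists_eq_pow_of_mul_eq_pow
      (Nat.isUnit_iff.mpr hcop.coprime_mul_left.symm) hsq
    exact Or.inl (two_pow_add_three_pow_eq_sq hk hlt hb)
  · rw [he, mul_left_comm] at hmul
    have hsq := Nat.eq_of_mul_eq_mul_left (by norm_num) hmul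
    rw [he] at hcop
    obtain ⟨a, ha⟩ := exists_eq_pow_of_mul_eq_pow
      (Nat.isUnit_iff.mpr hcop.coprime_mul_left_right) hsq
    exact Or.inr (sq_add_three_pow_eq_two_pow (a := a) hk (by omega))


/-- The equation `7·x² + 3^m = 2^(n+2)` has exactly the two positive
solutions `(1,2,2)` and `(5,4,6)`; in particular every solution has `m`
even. -/
theorem stmt_19 :
    {p : ℕ × ℕ × ℕ | 0 < p.1 ∧ 0 < p.2.1 ∧ 0 < p.2.2 ∧
        7 * p.1 ^ 2 + 3 ^ p.2.1 = 2 ^ (p.2.2 + 2)} =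
      {(1, 2, 2), (5, 4, 6)} ∧
    ∀ x m n : ℕ, 0 < x → 0 < m → 0 < n →
      7 * x ^ 2 + 3 ^ m = 2 ^ (n + 2) → Even m := by
  refine ⟨?_, fun x m n _ _ hn h => even_of_seven_mul_sq_add_three_pow hn h⟩
  ext ⟨x, m, n⟩
  simp only [Set.mem_ofPred_eq, Set.mem_insert_iff, Set.mem_singleton_iff, Prod.mk.injEq]
  constructor
  · rintro ⟨hx, hm, hn, h⟩
    obtain ⟨k, rfl⟩ := even_of_seven_mul_sq_add_three_pow hn h
    have h3 : 3 ∣ 3 ^ (k + k) := dvd_pow_self 3 hm.ne'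
    obtain ⟨s, hs⟩ := even_of_two_pow_mod_three (s := n + 2) (a := x) (by omega)
    rw [hs] at h
    rcases exponents_of_seven_mul_sq_add_nine_pow hx (by omega) h with ⟨rfl, rfl⟩ | ⟨rfl, rfl⟩
    · right
      refine ⟨Nat.pow_left_injective two_ne_zero ?_, rfl, by omega⟩
      change x ^ 2 = 5 ^ 2
      omega
    · left
      refine ⟨Nat.pow_left_injective two_ne_zero ?_, rfl, by omega⟩
      change x ^ 2 = 1 ^ 2
      omega
  · rintro (⟨rfl, rfl, rfl⟩ | ⟨rfl, rfl, rfl⟩) <;> norm_num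
end
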